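/- arXiv:2403.02492 — 2 statements merged into one kernel-verified Lean document; each statement's English description precedes it below -/
import Mathlib

section
/- Let (E_i) be the fixed uniform enumeration of all ceers, let S ⊆ ℕ be proper on the infinite ceers, and let C ⊆ ℕ be any Σ⁰₃-complete set (with respect to many-one reducibility). If [S] ≤_m C, then C ≤_1 [S]; in particular, neither [S] <_m C nor [S] <_1 C can hold. -/
/-- The `e`-th computably enumerable subset of `ℕ`: the domain of the `e`-th partial
computable function. -/
def W (e : ℕ) : Set ℕ := {n | ((Denumerable.ofNat Nat.Partrec.Code e).eval n).Dom}

/-- A set `S ⊆ ℕ` is Σ⁰₃ if there is a computable predicate `R ⊆ ℕ⁴` with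
`n ∈ S ↔ ∃x ∀y ∃z, R n x y z`. -/
def IsSigma03 (S : Set ℕ) : Prop :=
  ∃ R : ℕ → ℕ → ℕ → ℕ → Bool,
    (Computable fun p : ℕ × ℕ × ℕ × ℕ => R p.1 p.2.1 p.2.2.1 p.2.2.2) ∧
    ∀ n, n ∈ S ↔ ∃ x, ∀ y, ∃ z, R n x y z = true

/-- A binary relation on `ℕ` is Σ⁰₃ if the corresponding set of codes of pairs
(under the standard computable pairing) is Σ⁰₃. -/
def Sigma03Rel (E : ℕ → ℕ → Prop) : Prop :=
  IsSigma03 {p : ℕ | E p.unpair.1 p.unpair.2}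

/-- `E` computably reduces to `F`: there is a total computable `Φ` with
`m E n ↔ Φ(m) F Φ(n)`. -/
def ComputableReduction (E F : ℕ → ℕ → Prop) : Prop :=
  ∃ Φ : ℕ → ℕ, Computable Φ ∧ ∀ m n, E m n ↔ F (Φ m) (Φ n)

/-- `E` and `F` are computably equivalent: computable reductions exist in both directions. -/
def CeerEquiv (E F : ℕ → ℕ → Prop) : Prop :=
  ComputableReduction E F ∧ ComputableReduction F E

/-- The fixed uniform enumeration of all ceers: `ceer i` is the equivalence relation
generated by the `i`-th c.e. set `W i` of coded pairs. -/
def ceer (i : ℕ) : ℕ → ℕ → Prop :=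
  Relation.EqvGen fun m n => Nat.pair m n ∈ W i

/-- `[S]`: the closure of a set of indices of ceers under computable equivalence. -/
def ceerClosure (S : Set ℕ) : Set ℕ := {i | ∃ j ∈ S, CeerEquiv (ceer i) (ceer j)}

/-- An equivalence relation on `ℕ` has infinitely many classes iff there is an infinite
family of pairwise inequivalent elements. -/
def HasInfinitelyManyClasses (E : ℕ → ℕ → Prop) : Prop :=
  ∃ f : ℕ → ℕ, ∀ m n, m ≠ n → ¬E (f m) (f n)

/-- `S` is proper on the infinite ceers: some ceer with infinitely many classes has its
index in `[S]` and some ceer with infinitely many classes has its index outside `[S]`. -/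
def ProperOnInfiniteCeers (S : Set ℕ) : Prop :=
  ∃ i j, HasInfinitelyManyClasses (ceer i) ∧ HasInfinitelyManyClasses (ceer j) ∧
    i ∈ ceerClosure S ∧ j ∉ ceerClosure S

/-- The map induced on class indices by an operation `o = (i, j)`: if `i < j`, the `j`-th class is
merged into the `i`-th one and later classes shift down; otherwise nothing happens. -/
def mergeIndex (o : ℕ × ℕ) (k : ℕ) : ℕ :=
  if o.1 < o.2 then (if k < o.2 then k else if k = o.2 then o.1 else k - 1) else k

theorem mergeIndex_le (o : ℕ × ℕ) (k : ℕ) : mergeIndex o k ≤ k := by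
  unfold mergeIndex; grind

theorem mergeIndex_of_lt {o : ℕ × ℕ} {k : ℕ} (h : k < o.2) : mergeIndex o k = k := by
  unfold mergeIndex; grind

theorem mergeIndex_of_le {o : ℕ × ℕ} (h : o.2 ≤ o.1) (k : ℕ) : mergeIndex o k = k := by
  unfold mergeIndex; grind

theorem mergeIndex_lt {o : ℕ × ℕ} {k : ℕ} (h : o.1 < o.2) (hk : o.2 ≤ k) : mergeIndex o k < k := by
  unfold mergeIndex; grind

theorem exists_mergeIndex_eq (o : ℕ × ℕ) (k : ℕ) : ∃ l, mergeIndex o l = k := by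
  by_cases h : o.1 < o.2 ∧ o.2 ≤ k
  · exact ⟨k + 1, by unfold mergeIndex; grind⟩
  · exact ⟨k, by unfold mergeIndex; grind⟩

theorem mergeIndex_eq_iff (o : ℕ × ℕ) (k l : ℕ) : mergeIndex o k = mergeIndex o l ↔
    k = l ∨ (o.1 < o.2 ∧ (k = o.1 ∧ l = o.2 ∨ k = o.2 ∧ l = o.1)) := by
  unfold mergeIndex; grind

/-- The index of the class of `u` after `s` merge operations, starting from the identity
relation. -/
def classIndex (o : ℕ → ℕ × ℕ) (s u : ℕ) : ℕ :=
  Nat.rec u (fun t k => mergeIndex (o t) k) s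

theorem classIndex_succ (o : ℕ → ℕ × ℕ) (s u : ℕ) :
    classIndex o (s + 1) u = mergeIndex (o s) (classIndex o s u) := rfl

theorem classIndex_antitone (o : ℕ → ℕ × ℕ) (u : ℕ) : Antitone fun s => classIndex o s u :=
  antitone_nat_of_succ_le fun _ => mergeIndex_le _ _

theorem classIndex_le (o : ℕ → ℕ × ℕ) (s u : ℕ) : classIndex o s u ≤ u :=
  classIndex_antitone o u (Nat.zero_le s)

theorem exists_classIndex_eq (o : ℕ → ℕ × ℕ) (s k : ℕ) : ∃ u, classIndex o s u = k := by
  induction s generalizing k with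
  | zero => exact ⟨k, rfl⟩
  | succ s ih =>
    obtain ⟨l, rfl⟩ := exists_mergeIndex_eq (o s) k
    obtain ⟨u, rfl⟩ := ih l
    exact ⟨u, rfl⟩

theorem classIndex_eq_mono {o : ℕ → ℕ × ℕ} {s t u v : ℕ} (hst : s ≤ t)
    (h : classIndex o s u = classIndex o s v) : classIndex o t u = classIndex o t v := by
  induction t, hst using Nat.le_induction with
  | base => exact h
  | succ t _ ih => rw [classIndex_succ, classIndex_succ, ih]

/-- The equivalence relation obtained from a sequence of merge operations. -/
def mergeRel (o : ℕ → ℕ × ℕ) (u v : ℕ) : Prop :=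
  ∃ s, classIndex o s u = classIndex o s v

theorem mergeRel_equivalence (o : ℕ → ℕ × ℕ) : Equivalence (mergeRel o) where
  refl _ := ⟨0, rfl⟩
  symm := fun ⟨s, h⟩ => ⟨s, h.symm⟩
  trans := fun ⟨s, h⟩ ⟨t, k⟩ => ⟨max s t, (classIndex_eq_mono (le_max_left s t) h).trans
    (classIndex_eq_mono (le_max_right s t) k)⟩

/-- If infinitely many classes survive, each index is the target of only finitely many proper
merge operations. -/
theorem exists_forall_le_of_infinite {o : ℕ → ℕ × ℕ}
    (h : HasInfinitelyManyClasses (mergeRel o)) (r : ℕ) :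
    ∃ s₀, ∀ s ≥ s₀, (o s).1 < (o s).2 → r ≤ (o s).2 := by
  obtain ⟨f, hf⟩ := h
  let φ : ℕ → ℕ := fun s => ∑ i ∈ Finset.range (r + 1), classIndex o s (f i)
  let s₀ := Function.argmin φ
  refine ⟨s₀, fun s hs hlt => ?_⟩
  by_contra! hr
  have hinj : Set.InjOn (fun i => classIndex o s (f i)) (Finset.range (r + 1) : Set ℕ) := by
    intro i _ j _ hij
    by_contra hne
    exact hf i j hne ⟨s, hij⟩
  obtain ⟨i, hi, hri⟩ : ∃ i ∈ Finset.range (r + 1), r ≤ classIndex o s (f i) := by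
    by_contra! hcon
    have := Finset.card_le_card_of_injOn _
      (fun i hi => Finset.mem_coe.2 (Finset.mem_range.2 (hcon i hi))) hinj
    simp at this
  have h1 : φ (s + 1) < φ s :=
    Finset.sum_lt_sum (fun i _ => mergeIndex_le _ _)
      ⟨i, hi, mergeIndex_lt hlt (hr.le.trans hri)⟩
  have h2 : φ s ≤ φ s₀ := Finset.sum_le_sum fun i _ => classIndex_antitone o (f i) hs
  exact absurd (h1.trans_le h2) (Function.not_lt_argmin φ (s + 1))

/-- The number of stages before `s` at which `w` is active. -/
def activeCount (x : ℕ → ℕ) (w s : ℕ) : ℕ :=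
  Nat.rec 0 (fun t k => if x t = w then k + 1 else k) s

/-- The bound imposed on `w` at stage `s` by requirements of higher priority. -/
def restraint (x : ℕ → ℕ) (w s : ℕ) : ℕ :=
  Nat.rec 0 (fun t k => if x t < w then t + 1 else k) s

theorem activeCount_succ (x : ℕ → ℕ) (w s : ℕ) : activeCount x w (s + 1) =
    if x s = w then activeCount x w s + 1 else activeCount x w s := rfl

theorem restraint_succ (x : ℕ → ℕ) (w s : ℕ) : restraint x w (s + 1) =
    if x s < w then s + 1 else restraint x w s := rfl

theorem activeCount_monotone (x : ℕ → ℕ) (w : ℕ) : Monotone (activeCount x w) :=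
  monotone_nat_of_le_succ fun s => by rw [activeCount_succ]; split <;> omega

theorem restraint_le (x : ℕ → ℕ) (w s : ℕ) : restraint x w s ≤ s := by
  induction s with
  | zero => exact le_rfl
  | succ s ih => rw [restraint_succ]; split <;> omega

theorem lt_restraint {x : ℕ → ℕ} {w s t : ℕ} (hts : t < s) (ht : x t < w) :
    t < restraint x w s := by
  induction s, hts using Nat.le_induction with
  | base => rw [restraint_succ, if_pos ht]; exact Nat.lt_succ_self t
  | succ s hs ih =>
    have : t < s := hs
    rw [restraint_succ]; split <;> omega

theorem restraint_eq {x : ℕ → ℕ} {w s t : ℕ} (hx : ∀ p ≥ s, w ≤ x p) (hst : s ≤ t) :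
    restraint x w t = restraint x w s := by
  induction t, hst using Nat.le_induction with
  | base => rfl
  | succ t ht ih => rw [restraint_succ, if_neg (hx t ht).not_gt, ih]

theorem exists_le_activeCount {x : ℕ → ℕ} {w : ℕ} (hx : ∀ s, ∃ t ≥ s, x t = w) (N : ℕ) :
    ∃ s, N ≤ activeCount x w s := by
  induction N with
  | zero => exact ⟨0, Nat.zero_le _⟩
  | succ N ih =>
    obtain ⟨s, hs⟩ := ih
    obtain ⟨t, hst, ht⟩ := hx s
    refine ⟨t + 1, ?_⟩
    rw [activeCount_succ, if_pos ht]
    exact Nat.succ_le_succ (hs.trans (activeCount_monotone x w hst))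

/-- The merge operation performed at stage `s` by a priority construction in which `x s` is the
active requirement and `o w` is the sequence of operations that requirement `w` copies. -/
def priorityOp (x : ℕ → ℕ) (o : ℕ → ℕ → ℕ × ℕ) (s : ℕ) : ℕ × ℕ :=
  if restraint x (x s) s ≤ (o (x s) (activeCount x (x s) s)).2 then
    o (x s) (activeCount x (x s) s) else (0, 0)

/-- The class of `u` in the priority construction is eventually matched with the class of `a` in
the relation copied by `w`. -/
def Matched (x : ℕ → ℕ) (o : ℕ → ℕ → ℕ × ℕ) (w u a : ℕ) : Prop :=
  ∃ s₀, ∀ s ≥ s₀, classIndex (priorityOp x o) s u = classIndex (o w) (activeCount x w s) a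

theorem mergeRel_iff_of_matched {x : ℕ → ℕ} {o : ℕ → ℕ → ℕ × ℕ} {w u v a b : ℕ}
    (hx : ∀ s, ∃ t ≥ s, x t = w) (hu : Matched x o w u a) (hv : Matched x o w v b) :
    mergeRel (priorityOp x o) u v ↔ mergeRel (o w) a b := by
  obtain ⟨s, hs⟩ := hu
  obtain ⟨t, ht⟩ := hv
  constructor
  · rintro ⟨p, hp⟩
    have := classIndex_eq_mono (le_max_left p (max s t)) hp
    rw [hs _ (by omega), ht _ (by omega)] at this
    exact ⟨_, this⟩
  · rintro ⟨p, hp⟩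
    obtain ⟨q, hq⟩ := exists_le_activeCount hx p
    have := classIndex_eq_mono
      (hq.trans (activeCount_monotone x w (le_max_left q (max s t)))) hp
    rw [← hs _ (by omega), ← ht _ (by omega)] at this
    exact ⟨_, this⟩

/-- From some stage on, classes whose indices agree when `w` is active, and are small, remain
matched. -/
theorem exists_forall_matched {x : ℕ → ℕ} {o : ℕ → ℕ → ℕ × ℕ} {w : ℕ}
    (hinf : HasInfinitelyManyClasses (mergeRel (o w)))
    (hx : ∀ s, ∃ t ≥ s, x t = w) (hlow : ∃ s, ∀ t ≥ s, w ≤ x t) :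
    ∃ s₁, ∀ t ≥ s₁, x t = w → ∀ u a, classIndex (priorityOp x o) (t + 1) u ≤ t →
      classIndex (priorityOp x o) (t + 1) u = classIndex (o w) (activeCount x w (t + 1)) a →
      Matched x o w u a := by
  obtain ⟨s₀, hs₀⟩ := hlow
  obtain ⟨n₀, hn₀⟩ := exists_forall_le_of_infinite hinf s₀
  obtain ⟨p, hp⟩ := exists_le_activeCount hx n₀
  refine ⟨max s₀ p, fun t ht hxt u a hle heq => ⟨t + 1, fun s hs => ?_⟩⟩
  induction s, hs using Nat.le_induction with
  | base => exact heq
  | succ s hs ih =>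
    have hlow := hs₀ s (by omega)
    rw [classIndex_succ, activeCount_succ]
    rcases hlow.eq_or_lt with hw | hw
    · rw [if_pos hw.symm, classIndex_succ, ← ih]
      have hr : restraint x w s ≤ s₀ := by
        rw [restraint_eq hs₀ (by omega)]; exact restraint_le x w s₀
      have hn : n₀ ≤ activeCount x w s := hp.trans (activeCount_monotone x w (by omega))
      unfold priorityOp
      rw [← hw]
      split_ifs with h
      · rfl
      · rw [mergeIndex_of_le le_rfl, mergeIndex_of_le]
        by_contra! hlt
        exact h (hr.trans (hn₀ _ hn hlt))
    · rw [if_neg hw.ne', ← ih]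
      have hr : t < restraint x (x s) s := lt_restraint (by omega) (by omega)
      have hc : classIndex (priorityOp x o) s u ≤ t :=
        (classIndex_antitone _ u hs).trans hle
      unfold priorityOp
      split_ifs with h
      · exact mergeIndex_of_lt (by unfold priorityOp at hc; omega)
      · exact mergeIndex_of_le le_rfl _

theorem primrec₂_mergeIndex : Primrec₂ mergeIndex := by
  have h1 : Primrec fun p : (ℕ × ℕ) × ℕ => p.1.1 := Primrec.fst.comp Primrec.fst
  have h2 : Primrec fun p : (ℕ × ℕ) × ℕ => p.1.2 := Primrec.snd.comp Primrec.fst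
  have h3 : Primrec fun p : (ℕ × ℕ) × ℕ => p.2 := Primrec.snd
  exact Primrec.ite (Primrec.nat_lt.comp h1 h2)
    (Primrec.ite (Primrec.nat_lt.comp h3 h2) h3
      (Primrec.ite (Primrec.eq.comp h3 h2) h1 (Primrec.pred.comp h3))) h3

section Primrec

variable {α β : Type*} [Primcodable α] [Primcodable β]

theorem primrec_classIndex {o : α → ℕ → ℕ × ℕ} (ho : Primrec₂ o) {f : β → α} {g h : β → ℕ}
    (hf : Primrec f) (hg : Primrec g) (hh : Primrec h) :
    Primrec fun b => classIndex (o (f b)) (g b) (h b) :=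
  Primrec.nat_rec' hg hh <| Primrec.to₂ <| primrec₂_mergeIndex.comp
    (ho.comp (hf.comp Primrec.fst) (Primrec.fst.comp Primrec.snd)) (Primrec.snd.comp Primrec.snd)

theorem primrec_activeCount {x : α → ℕ → ℕ} (hx : Primrec₂ x) {f : β → α} {g h : β → ℕ}
    (hf : Primrec f) (hg : Primrec g) (hh : Primrec h) :
    Primrec fun b => activeCount (x (f b)) (g b) (h b) :=
  Primrec.nat_rec' hh (Primrec.const 0) <| Primrec.to₂ <| Primrec.ite
    (Primrec.eq.comp (hx.comp (hf.comp Primrec.fst) (Primrec.fst.comp Primrec.snd))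
      (hg.comp Primrec.fst))
    (Primrec.succ.comp (Primrec.snd.comp Primrec.snd)) (Primrec.snd.comp Primrec.snd)

theorem primrec_restraint {x : α → ℕ → ℕ} (hx : Primrec₂ x) {f : β → α} {g h : β → ℕ}
    (hf : Primrec f) (hg : Primrec g) (hh : Primrec h) :
    Primrec fun b => restraint (x (f b)) (g b) (h b) :=
  Primrec.nat_rec' hh (Primrec.const 0) <| Primrec.to₂ <| Primrec.ite
    (Primrec.nat_lt.comp (hx.comp (hf.comp Primrec.fst) (Primrec.fst.comp Primrec.snd))
      (hg.comp Primrec.fst))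
    (Primrec.succ.comp (Primrec.fst.comp Primrec.snd)) (Primrec.snd.comp Primrec.snd)

theorem primrec₂_priorityOp {x : α → ℕ → ℕ} (hx : Primrec₂ x) {o : ℕ → ℕ → ℕ × ℕ}
    (ho : Primrec₂ o) : Primrec₂ fun a s => priorityOp (x a) o s := by
  have hw : Primrec fun p : α × ℕ => x p.1 p.2 := hx
  have hop := ho.comp hw (primrec_activeCount hx Primrec.fst hw Primrec.snd)
  exact Primrec.ite (Primrec.nat_le.comp
    (primrec_restraint hx Primrec.fst hw Primrec.snd) (Primrec.snd.comp hop))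
    hop (Primrec.const (0, 0))

end Primrec

theorem exists_computable_choice {R : ℕ → ℕ → Bool} (hR : Primrec₂ R)
    (h : ∀ u, ∃ p, R u p = true) : ∃ f : ℕ → ℕ, Computable f ∧ ∀ u, R u (f u) = true := by
  refine ⟨fun u => Nat.find (h u), ?_, fun u => Nat.find_spec (h u)⟩
  refine (Partrec.rfind hR.to_comp.partrec₂).of_eq_tot fun u => ?_
  refine Nat.mem_rfind.2 ⟨?_, fun {m} hm => ?_⟩
  · simpa using Nat.find_spec (h u)
  · simpa using Nat.find_min (h u) hm

/-- If `w` is the least requirement which is active infinitely often, the priority construction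
produces a relation equivalent to the one copied by `w`. -/
theorem ceerEquiv_priorityOp {x : ℕ → ℕ} (hxp : Primrec x) {o : ℕ → ℕ → ℕ × ℕ}
    (ho : Primrec₂ o) {w : ℕ} (hinf : HasInfinitelyManyClasses (mergeRel (o w)))
    (hx : ∀ s, ∃ t ≥ s, x t = w) (hlow : ∃ s, ∀ t ≥ s, w ≤ x t) :
    CeerEquiv (mergeRel (priorityOp x o)) (mergeRel (o w)) := by
  obtain ⟨s₁, hs₁⟩ := exists_forall_matched hinf hx hlow
  have key : ∀ u a t, (x t = w ∧ s₁ ≤ t ∧ classIndex (priorityOp x o) (t + 1) u ≤ t ∧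
      classIndex (priorityOp x o) (t + 1) u = classIndex (o w) (activeCount x w (t + 1)) a) →
      Matched x o w u a := fun u a t h => hs₁ t h.2.1 h.1 u a h.2.2.1 h.2.2.2
  have hprim : PrimrecPred fun q : ℕ × ℕ × ℕ => x q.2.2 = w ∧ s₁ ≤ q.2.2 ∧
      classIndex (priorityOp x o) (q.2.2 + 1) q.1 ≤ q.2.2 ∧
      classIndex (priorityOp x o) (q.2.2 + 1) q.1 =
        classIndex (o w) (activeCount x w (q.2.2 + 1)) q.2.1 := by
    have hxu : Primrec₂ fun (_ : Unit) s => x s := hxp.comp Primrec.snd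
    have hu : Primrec fun q : ℕ × ℕ × ℕ => q.1 := Primrec.fst
    have ha : Primrec fun q : ℕ × ℕ × ℕ => q.2.1 := Primrec.fst.comp Primrec.snd
    have ht : Primrec fun q : ℕ × ℕ × ℕ => q.2.2 := Primrec.snd.comp Primrec.snd
    have ht' : Primrec fun q : ℕ × ℕ × ℕ => q.2.2 + 1 := Primrec.succ.comp ht
    have hF := primrec_classIndex (primrec₂_priorityOp hxu ho) (Primrec.const ()) ht' hu
    have hA := primrec_classIndex ho (Primrec.const w)
      (primrec_activeCount hxu (Primrec.const ()) (Primrec.const w) ht') ha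
    exact (Primrec.eq.comp (hxp.comp ht) (Primrec.const w)).and
      ((Primrec.nat_le.comp (Primrec.const s₁) ht).and
        ((Primrec.nat_le.comp hF ht).and (Primrec.eq.comp hF hA)))
  have hunp : Primrec fun p : ℕ × ℕ => p.2.unpair := Primrec.unpair.comp Primrec.snd
  have hp1 := Primrec.fst.comp hunp
  have hp2 := Primrec.snd.comp hunp
  constructor
  · obtain ⟨f, hf, hfm⟩ := exists_computable_choice
      (R := fun u p => decide (x p.unpair.2 = w ∧ s₁ ≤ p.unpair.2 ∧
        classIndex (priorityOp x o) (p.unpair.2 + 1) u ≤ p.unpair.2 ∧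
        classIndex (priorityOp x o) (p.unpair.2 + 1) u =
          classIndex (o w) (activeCount x w (p.unpair.2 + 1)) p.unpair.1))
      (hprim.comp (Primrec.fst.pair (hp1.pair hp2))).decide (fun u => by
        obtain ⟨t, ht, hxt⟩ := hx (max s₁ u)
        obtain ⟨a, ha⟩ := exists_classIndex_eq (o w) (activeCount x w (t + 1))
          (classIndex (priorityOp x o) (t + 1) u)
        refine ⟨Nat.pair a t, decide_eq_true ?_⟩
        rw [Nat.unpair_pair]
        exact ⟨hxt, by omega, (classIndex_le _ _ _).trans (by omega), ha.symm⟩)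
    have hm : ∀ u, Matched x o w u (f u).unpair.1 := fun u => key _ _ _ (of_decide_eq_true (hfm u))
    exact ⟨fun u => (f u).unpair.1, Computable.fst.comp (Computable.unpair.comp hf),
      fun u v => mergeRel_iff_of_matched hx (hm u) (hm v)⟩
  · obtain ⟨f, hf, hfm⟩ := exists_computable_choice
      (R := fun a p => decide (x p.unpair.2 = w ∧ s₁ ≤ p.unpair.2 ∧
        classIndex (priorityOp x o) (p.unpair.2 + 1) p.unpair.1 ≤ p.unpair.2 ∧
        classIndex (priorityOp x o) (p.unpair.2 + 1) p.unpair.1 =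
          classIndex (o w) (activeCount x w (p.unpair.2 + 1)) a))
      (hprim.comp (hp1.pair (Primrec.fst.pair hp2))).decide (fun a => by
        obtain ⟨t, ht, hxt⟩ := hx (max s₁ a)
        obtain ⟨u, hu⟩ := exists_classIndex_eq (priorityOp x o) (t + 1)
          (classIndex (o w) (activeCount x w (t + 1)) a)
        refine ⟨Nat.pair u t, decide_eq_true ?_⟩
        rw [Nat.unpair_pair]
        exact ⟨hxt, by omega, by rw [hu]; exact (classIndex_le _ _ _).trans (by omega), hu⟩)
    have hm : ∀ a, Matched x o w (f a).unpair.1 a := fun a => key _ _ _ (of_decide_eq_true (hfm a))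
    exact ⟨fun a => (f a).unpair.1, Computable.fst.comp (Computable.unpair.comp hf),
      fun a b => (mergeRel_iff_of_matched hx (hm a) (hm b)).symm⟩

/-- The operation merging the classes of `a` and `b`, where `s` codes a triple `(a, b, k)`, if
`c` converges on `(a, b)` within `k` steps; `l` lists the earlier operations, latest first. -/
def ceerStep (c : Nat.Partrec.Code) (l : List (ℕ × ℕ)) (s : ℕ) : ℕ × ℕ :=
  bif (c.evaln s.unpair.2 s.unpair.1).isSome then
    (min (l.foldr mergeIndex s.unpair.1.unpair.1) (l.foldr mergeIndex s.unpair.1.unpair.2),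
      max (l.foldr mergeIndex s.unpair.1.unpair.1) (l.foldr mergeIndex s.unpair.1.unpair.2))
  else (0, 0)

/-- The first `s` merge operations enumerating the equivalence relation generated by the domain
of `c`, latest first. -/
def ceerHistory (c : Nat.Partrec.Code) (s : ℕ) : List (ℕ × ℕ) :=
  Nat.rec [] (fun t l => ceerStep c l t :: l) s

/-- A sequence of merge operations enumerating the equivalence relation generated by the domain
of `c`. -/
def ceerOp (c : Nat.Partrec.Code) (s : ℕ) : ℕ × ℕ :=
  ceerStep c (ceerHistory c s) s

theorem foldr_ceerHistory (c : Nat.Partrec.Code) (s u : ℕ) :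
    (ceerHistory c s).foldr mergeIndex u = classIndex (ceerOp c) s u := by
  induction s with
  | zero => rfl
  | succ s ih =>
    rw [classIndex_succ, ← ih]
    rfl

theorem primrec_ceerOp (c : Nat.Partrec.Code) : Primrec (ceerOp c) := by
  have hstep : Primrec₂ (ceerStep c) := by
    have hs : Primrec fun p : List (ℕ × ℕ) × ℕ => p.2.unpair := Primrec.unpair.comp Primrec.snd
    have hab : Primrec fun p : List (ℕ × ℕ) × ℕ => p.2.unpair.1.unpair :=
      Primrec.unpair.comp (Primrec.fst.comp hs)
    have hm : Primrec₂ fun (_ : List (ℕ × ℕ) × ℕ) (q : (ℕ × ℕ) × ℕ) => mergeIndex q.1 q.2 :=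
      primrec₂_mergeIndex.comp (Primrec.fst.comp Primrec.snd) (Primrec.snd.comp Primrec.snd)
    have ha := Primrec.list_foldr (Primrec.fst (α := List (ℕ × ℕ)) (β := ℕ))
      (Primrec.fst.comp hab) hm
    have hb := Primrec.list_foldr (Primrec.fst (α := List (ℕ × ℕ)) (β := ℕ))
      (Primrec.snd.comp hab) hm
    exact Primrec.cond (Primrec.option_isSome.comp (Nat.Partrec.Code.primrec_evaln.comp
      (((Primrec.snd.comp hs).pair (Primrec.const c)).pair (Primrec.fst.comp hs))))
      ((Primrec.nat_min.comp ha hb).pair (Primrec.nat_max.comp ha hb)) (Primrec.const (0, 0))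
  have hhist : Primrec (ceerHistory c) := Primrec.nat_rec₁ [] <| Primrec.to₂ <|
    Primrec.list_cons.comp (hstep.comp Primrec.snd Primrec.fst) Primrec.snd
  exact hstep.comp hhist Primrec.id

theorem mergeRel_ceerOp (i : ℕ) :
    mergeRel (ceerOp (Denumerable.ofNat Nat.Partrec.Code i)) = ceer i := by
  set c := Denumerable.ofNat Nat.Partrec.Code i with hc
  have hsound : ∀ s u v, classIndex (ceerOp c) s u = classIndex (ceerOp c) s v → ceer i u v := by
    intro s
    induction s with
    | zero => rintro u v h; exact (show u = v from h) ▸ Relation.EqvGen.refl u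
    | succ s ih =>
      intro u v h
      rw [classIndex_succ, classIndex_succ, mergeIndex_eq_iff] at h
      rcases h with h | ⟨hlt, h⟩
      · exact ih u v h
      simp only [ceerOp, ceerStep, foldr_ceerHistory] at hlt h
      rcases hev : (c.evaln s.unpair.2 s.unpair.1).isSome with _ | _
      · simp [hev] at hlt
      rw [hev] at h
      have hW : s.unpair.1 ∈ W i := by
        obtain ⟨y, hy⟩ := Option.isSome_iff_exists.1 hev
        exact Part.dom_iff_mem.2 ⟨y, Nat.Partrec.Code.evaln_sound hy⟩
      have hab : ceer i s.unpair.1.unpair.1 s.unpair.1.unpair.2 :=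
        Relation.EqvGen.rel _ _ (by rwa [Nat.pair_unpair])
      have hcases : ∀ a b k l : ℕ, k = min a b ∧ l = max a b ∨ k = max a b ∧ l = min a b →
          k = a ∧ l = b ∨ k = b ∧ l = a := by grind
      rcases hcases _ _ _ _ h with ⟨h1, h2⟩ | ⟨h1, h2⟩
      · exact .trans _ _ _ (ih _ _ h1) (.trans _ _ _ hab (.symm _ _ (ih _ _ h2)))
      · exact .trans _ _ _ (ih _ _ h1)
          (.trans _ _ _ (.symm _ _ hab) (.symm _ _ (ih _ _ h2)))
  have hcomplete : ∀ a b, Nat.pair a b ∈ W i → mergeRel (ceerOp c) a b := by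
    intro a b h
    obtain ⟨y, hy⟩ := Part.dom_iff_mem.1 h
    obtain ⟨k, hk⟩ := Nat.Partrec.Code.evaln_complete.1 hy
    have hev : (c.evaln k (Nat.pair a b)).isSome = true :=
      Option.isSome_iff_exists.2 ⟨y, hk⟩
    refine ⟨Nat.pair (Nat.pair a b) k + 1, ?_⟩
    rw [classIndex_succ, classIndex_succ, mergeIndex_eq_iff]
    simp only [ceerOp, ceerStep, foldr_ceerHistory, Nat.unpair_pair, hev, cond_true]
    grind
  funext u v
  refine propext ⟨fun ⟨s, hs⟩ => hsound s u v hs, fun h => ?_⟩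
  exact ((mergeRel_equivalence (ceerOp c)).eqvGen_iff).1 (Relation.EqvGen.mono hcomplete _ _ h)

theorem exists_code_dom_iff {R : ℕ → ℕ → ℕ → Bool}
    (hR : Computable fun p : (ℕ × ℕ) × ℕ => R p.1.1 p.1.2 p.2) :
    ∃ c : Nat.Partrec.Code, ∀ v y,
      (c.eval (Nat.pair v y)).Dom ↔ ∀ y' ≤ y, ∃ z, R v y' z = true := by
  have hg : Partrec fun p : ℕ × ℕ => Nat.rfind fun z => Part.some (R p.1 p.2 z) :=
    Partrec.rfind (Computable.partrec hR)
  let ψ : ℕ → ℕ → Part ℕ := fun v y => Nat.rec (Part.some 0)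
    (fun y' ih => ih.bind fun _ => Nat.rfind fun z => Part.some (R v y' z)) y
  have hψ : Partrec fun a : ℕ => ψ a.unpair.1 (a.unpair.2 + 1) :=
    Partrec.nat_rec (Computable.succ.comp (Computable.snd.comp Computable.unpair))
      (Computable.const 0).partrec <| Partrec.to₂ <| hg.comp <|
        (Computable.fst.comp (Computable.unpair.comp Computable.fst)).pair
          (Computable.fst.comp Computable.snd)
  have hdom : ∀ v y, (ψ v y).Dom ↔ ∀ y' < y, ∃ z, R v y' z = true := by
    intro v y
    induction y with
    | zero => exact ⟨fun _ y' hy => absurd hy (Nat.not_lt_zero y'), fun _ => trivial⟩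
    | succ y ih =>
      have h1 : (ψ v (y + 1)).Dom ↔
          (ψ v y).Dom ∧ (Nat.rfind fun z => Part.some (R v y z)).Dom := by
        change (Part.bind (ψ v y) _).Dom ↔ _
        rw [Part.bind_dom]
        exact exists_prop
      have h2 : (Nat.rfind fun z => Part.some (R v y z)).Dom ↔ ∃ z, R v y z = true :=
        Nat.rfind_dom.trans ⟨fun ⟨z, hz, _⟩ => ⟨z, (Part.mem_some_iff.1 hz).symm⟩,
          fun ⟨z, hz⟩ => ⟨z, Part.mem_some_iff.2 hz.symm, fun _ => trivial⟩⟩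
      rw [h1, ih, h2, Nat.forall_lt_succ_right]
  obtain ⟨c, hc⟩ := Nat.Partrec.Code.exists_code.1 (Partrec.nat_iff.1 hψ)
  refine ⟨c, fun v y => ?_⟩
  simp only [hc, Nat.unpair_pair, hdom, Nat.lt_succ_iff]

/-- Stage `s`, coding a pair `(y, k)`, is the one at which `c` is first seen to converge
on `(v, y)`. -/
def firesAt (c : Nat.Partrec.Code) (v s : ℕ) : Bool :=
  (c.evaln (s.unpair.2 + 1) (Nat.pair v s.unpair.1)).isSome &&
    !(c.evaln s.unpair.2 (Nat.pair v s.unpair.1)).isSome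

theorem exists_firesAt {c : Nat.Partrec.Code} {v : ℕ}
    (h : ∀ y, (c.eval (Nat.pair v y)).Dom) (s : ℕ) : ∃ t ≥ s, firesAt c v t = true := by
  obtain ⟨a, ha⟩ := Part.dom_iff_mem.1 (h s)
  have hex : ∃ k, (c.evaln k (Nat.pair v s)).isSome = true := by
    obtain ⟨k, hk⟩ := Nat.Partrec.Code.evaln_complete.1 ha
    exact ⟨k, Option.isSome_iff_exists.2 ⟨a, hk⟩⟩
  have h0 : Nat.find hex ≠ 0 := by
    intro h0
    have := Nat.find_spec hex
    rw [h0] at this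
    simp [Nat.Partrec.Code.evaln] at this
  obtain ⟨k, hk⟩ := Nat.exists_eq_succ_of_ne_zero h0
  refine ⟨Nat.pair s k, Nat.left_le_pair s k, ?_⟩
  rw [firesAt, Nat.unpair_pair]
  have h1 := Nat.find_spec hex
  have h2 := Nat.find_min hex (m := k) (by omega)
  rw [hk] at h1
  simp only [Nat.succ_eq_add_one] at h1
  simp [h1, h2]

theorem eventually_not_firesAt {c : Nat.Partrec.Code} {v y₀ : ℕ}
    (h : ∀ y ≥ y₀, ¬(c.eval (Nat.pair v y)).Dom) :
    ∀ᶠ t in Filter.atTop, ¬firesAt c v t = true := by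
  have hle : ∀ s t, firesAt c v s = true → firesAt c v t = true →
      s.unpair.1 = t.unpair.1 → t.unpair.2 ≤ s.unpair.2 := by
    intro s t hs ht hst
    by_contra! hlt
    simp only [firesAt, Bool.and_eq_true, Bool.not_eq_true'] at hs ht
    obtain ⟨a, ha⟩ := Option.isSome_iff_exists.1 hs.1
    have := Nat.Partrec.Code.evaln_mono (Nat.succ_le_of_lt hlt) ha
    rw [hst] at this
    exact absurd ht.2 (by simp [Option.isSome_iff_exists.2 ⟨a, this⟩])
  have hfin : {t | firesAt c v t = true}.Finite := by
    refine Set.Finite.of_finite_image ((Set.finite_lt_nat y₀).subset ?_)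
      (f := fun t => t.unpair.1) ?_
    · rintro _ ⟨t, ht, rfl⟩
      by_contra! hy
      have ht' : firesAt c v t = true := ht
      simp only [firesAt, Bool.and_eq_true] at ht'
      obtain ⟨a, ha⟩ := Option.isSome_iff_exists.1 ht'.1
      exact h _ (not_lt.1 hy) (Part.dom_iff_mem.2 ⟨a, Nat.Partrec.Code.evaln_sound ha⟩)
    · intro s hs t ht hst
      have h2 : s.unpair.2 = t.unpair.2 :=
        le_antisymm (hle t s ht hs hst.symm) (hle s t hs ht hst)
      rw [← Nat.pair_unpair s, ← Nat.pair_unpair t, show s.unpair.1 = t.unpair.1 from hst, h2]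
  rw [← Nat.cofinite_eq_atTop]
  exact hfin.compl_mem_cofinite

/-- The highest-priority requirement firing at stage `s` for the parameter `q`. -/
def activeReq (c : Nat.Partrec.Code) (q s : ℕ) : ℕ :=
  (List.range s).findIdx fun w => firesAt c (Nat.pair q w) s

theorem activeReq_le {c : Nat.Partrec.Code} {q w s : ℕ}
    (h : firesAt c (Nat.pair q w) s = true) : activeReq c q s ≤ w := by
  by_contra! hlt
  have := List.not_of_lt_findIdx hlt
  simp [h] at this

theorem firesAt_activeReq {c : Nat.Partrec.Code} {q s : ℕ} (h : activeReq c q s < s) :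
    firesAt c (Nat.pair q (activeReq c q s)) s = true := by
  have := List.findIdx_getElem (xs := List.range s)
    (p := fun w => firesAt c (Nat.pair q w) s) (w := by simpa [activeReq] using h)
  simpa [activeReq] using this

theorem activeReq_of_least {c : Nat.Partrec.Code} {q w : ℕ}
    (hmono : ∀ w y y', y ≤ y' → (c.eval (Nat.pair (Nat.pair q w) y')).Dom →
      (c.eval (Nat.pair (Nat.pair q w) y)).Dom)
    (hw : ∀ y, (c.eval (Nat.pair (Nat.pair q w) y)).Dom)
    (hlt : ∀ w' < w, ¬∀ y, (c.eval (Nat.pair (Nat.pair q w') y)).Dom) :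
    (∀ s, ∃ t ≥ s, activeReq c q t = w) ∧ ∃ s, ∀ t ≥ s, w ≤ activeReq c q t := by
  have hev : ∀ᶠ t in Filter.atTop, ∀ w' ∈ Finset.range w,
      ¬firesAt c (Nat.pair q w') t = true := by
    refine (Filter.eventually_all_finset _).2 fun w' hw' => ?_
    obtain ⟨y₀, hy₀⟩ := not_forall.1 (hlt w' (Finset.mem_range.1 hw'))
    exact eventually_not_firesAt fun y hy hd => hy₀ (hmono w' y₀ y hy hd)
  obtain ⟨s₀, hs₀⟩ := Filter.eventually_atTop.1 hev
  have hle : ∀ t ≥ max s₀ w, w ≤ activeReq c q t := by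
    intro t ht
    by_contra! hcon
    exact hs₀ t (by omega) _ (Finset.mem_range.2 hcon) (firesAt_activeReq (by omega))
  refine ⟨fun s => ?_, _, hle⟩
  obtain ⟨t, ht, hf⟩ := exists_firesAt hw (max s (max s₀ w + 1))
  exact ⟨t, by omega, le_antisymm (activeReq_le hf) (hle t (by omega))⟩

theorem primrec₂_activeReq (c : Nat.Partrec.Code) : Primrec₂ (activeReq c) := by
  have hfire : Primrec₂ (firesAt c) := by
    have hs : Primrec fun p : ℕ × ℕ => p.2.unpair := Primrec.unpair.comp Primrec.snd
    have hn : Primrec fun p : ℕ × ℕ => Nat.pair p.1 p.2.unpair.1 :=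
      Primrec₂.natPair.comp Primrec.fst (Primrec.fst.comp hs)
    have hev {k : ℕ × ℕ → ℕ} (hk : Primrec k) :
        Primrec fun p : ℕ × ℕ => (c.evaln (k p) (Nat.pair p.1 p.2.unpair.1)).isSome :=
      Primrec.option_isSome.comp
        (Nat.Partrec.Code.primrec_evaln.comp ((hk.pair (Primrec.const c)).pair hn))
    exact Primrec.and.comp (hev (Primrec.succ.comp (Primrec.snd.comp hs)))
      (Primrec.not.comp (hev (Primrec.snd.comp hs)))
  exact Primrec.list_findIdx (Primrec.list_range.comp Primrec.snd) <| Primrec.to₂ <|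
    hfire.comp (Primrec₂.natPair.comp (Primrec.fst.comp Primrec.fst) Primrec.snd)
      (Primrec.snd.comp Primrec.fst)

/-- By the recursion theorem, the ceer given by a uniform sequence of merge operations may use
its own index as a parameter. -/
theorem exists_selfReferential_index {o : ℕ → ℕ → ℕ × ℕ} (ho : Primrec₂ o) :
    ∃ g : ℕ → ℕ, Computable g ∧ Function.Injective g ∧
      ∀ n, ceer (g n) = mergeRel (o (Nat.pair n (g n))) := by
  let idx : Nat.Partrec.Code → ℕ → ℕ := fun c n => Encodable.encode (c.curry n)
  let f : Nat.Partrec.Code → ℕ →. ℕ := fun c v => Nat.rfind fun s => Part.some <| decide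
    (classIndex (o (Nat.pair v.unpair.1 (idx c v.unpair.1))) s v.unpair.2.unpair.1 =
      classIndex (o (Nat.pair v.unpair.1 (idx c v.unpair.1))) s v.unpair.2.unpair.2)
  have hidx : Primrec₂ idx := Primrec.encode.comp Nat.Partrec.Code.primrec₂_curry
  have hf : Partrec₂ f := by
    refine Partrec.rfind (Computable.partrec (Primrec.to_comp ?_))
    have hv : Primrec fun p : (Nat.Partrec.Code × ℕ) × ℕ => p.1.2.unpair :=
      Primrec.unpair.comp (Primrec.snd.comp Primrec.fst)
    have hn := Primrec.fst.comp hv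
    have huv := Primrec.unpair.comp (Primrec.snd.comp hv)
    have hq := Primrec₂.natPair.comp hn (hidx.comp (Primrec.fst.comp Primrec.fst) hn)
    exact (Primrec.eq.comp
      (primrec_classIndex ho hq Primrec.snd (Primrec.fst.comp huv))
      (primrec_classIndex ho hq Primrec.snd (Primrec.snd.comp huv))).decide
  obtain ⟨c, hc⟩ := Nat.Partrec.Code.fixed_point₂ hf
  refine ⟨idx c, (hidx.comp (Primrec.const c) Primrec.id).to_comp, fun m n h =>
    (Nat.Partrec.Code.curry_inj (Encodable.encode_injective h)).2, fun n => ?_⟩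
  have hW : ∀ u v, Nat.pair u v ∈ W (idx c n) ↔ mergeRel (o (Nat.pair n (idx c n))) u v := by
    intro u v
    simp only [W, Set.mem_ofPred_eq, idx, Denumerable.ofNat_encode,
      Nat.Partrec.Code.eval_curry, hc, f, Nat.unpair_pair, mergeRel]
    exact Nat.rfind_dom.trans ⟨
      fun ⟨s, hs, _⟩ => ⟨s, of_decide_eq_true (Part.mem_some_iff.1 hs).symm⟩,
      fun ⟨s, hs⟩ => ⟨s, Part.mem_some_iff.2 (decide_eq_true hs).symm, fun _ => trivial⟩⟩
  funext u v
  rw [ceer, ← (mergeRel_equivalence (o (Nat.pair n (idx c n)))).eqvGen_eq]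
  congr 1
  funext u v
  exact propext (hW u v)

theorem ComputableReduction.trans {E F G : ℕ → ℕ → Prop} (h : ComputableReduction E F)
    (k : ComputableReduction F G) : ComputableReduction E G := by
  obtain ⟨Φ, hΦ, h⟩ := h
  obtain ⟨Ψ, hΨ, k⟩ := k
  exact ⟨Ψ ∘ Φ, hΨ.comp hΦ, fun m n => (h m n).trans (k _ _)⟩

theorem mem_ceerClosure_of_ceerEquiv {S : Set ℕ} {i j : ℕ} (h : CeerEquiv (ceer i) (ceer j))
    (hj : j ∈ ceerClosure S) : i ∈ ceerClosure S := by
  obtain ⟨k, hk, hjk⟩ := hj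
  exact ⟨k, hk, h.1.trans hjk.1, hjk.2.trans h.2⟩

theorem oneOneReducible_ceerClosure {S C : Set ℕ} (hproper : ProperOnInfiniteCeers S)
    (hC : IsSigma03 C) (hSC : (· ∈ ceerClosure S) ≤₀ (· ∈ C)) :
    (· ∈ C) ≤₁ (· ∈ ceerClosure S) := by
  obtain ⟨i, j, hi, hj, hiS, hjS⟩ := hproper
  obtain ⟨R, hR, hRC⟩ := hC
  obtain ⟨h, hh, hhC⟩ := hSC
  let par : ℕ → ℕ := fun v =>
    bif v.unpair.2.bodd then h v.unpair.1.unpair.2 else v.unpair.1.unpair.1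
  have hpar : Computable par := by
    have h2 := Computable.unpair.comp (Computable.fst.comp Computable.unpair)
    exact Computable.cond (Computable.nat_bodd.comp (Computable.snd.comp Computable.unpair))
      (hh.comp (Computable.snd.comp h2)) (Computable.fst.comp h2)
  obtain ⟨c, hc⟩ := exists_code_dom_iff (R := fun v y z => R (par v) v.unpair.2.div2 y z) <| by
    have hv : Computable fun p : (ℕ × ℕ) × ℕ => p.1.1 := Computable.fst.comp Computable.fst
    exact hR.comp ((hpar.comp hv).pair ((Computable.nat_div2.comp
      (Computable.snd.comp (Computable.unpair.comp hv))).pair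
      ((Computable.snd.comp Computable.fst).pair Computable.snd)))
  let o : ℕ → ℕ → ℕ × ℕ := fun w s => bif w.bodd then
    ceerOp (Denumerable.ofNat Nat.Partrec.Code j) s else
    ceerOp (Denumerable.ofNat Nat.Partrec.Code i) s
  have ho : Primrec₂ o := Primrec.cond (Primrec.nat_bodd.comp Primrec.fst)
    ((primrec_ceerOp _).comp Primrec.snd) ((primrec_ceerOp _).comp Primrec.snd)
  have horel : ∀ w, mergeRel (o w) = ceer (bif w.bodd then j else i) := by
    intro w
    cases hw : w.bodd <;> simp only [o, hw, cond_true, cond_false] <;> exact mergeRel_ceerOp _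
  obtain ⟨g, hg, hginj, hgrel⟩ := exists_selfReferential_index
    (primrec₂_priorityOp (primrec₂_activeReq c) ho)
  refine ⟨g, hg, hginj, fun n => ?_⟩
  let P : ℕ → Prop := fun w => ∀ y, (c.eval (Nat.pair (Nat.pair (Nat.pair n (g n)) w) y)).Dom
  have hP : ∀ w, P w ↔ ∀ y, ∃ z, R (bif w.bodd then h (g n) else n) w.div2 y z = true := by
    intro w
    simp only [P, hc, par, Nat.unpair_pair]
    exact ⟨fun H y => H y y le_rfl, fun H _ y' _ => H y'⟩
  have hleast : ∀ w, P w → ∃ w, P w ∧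
      CeerEquiv (ceer (g n)) (ceer (bif w.bodd then j else i)) := by
    classical
    intro w hw
    have hex : ∃ w, P w := ⟨w, hw⟩
    obtain ⟨hx, hlow⟩ := activeReq_of_least (q := Nat.pair n (g n)) (w := Nat.find hex)
      (fun w y y' hy => by rw [hc, hc]; exact fun H z hz => H z (hz.trans hy))
      (Nat.find_spec hex) (fun w' hw' => Nat.find_min hex hw')
    refine ⟨Nat.find hex, Nat.find_spec hex, ?_⟩
    rw [hgrel, ← horel]
    refine ceerEquiv_priorityOp ((primrec₂_activeReq c).comp (Primrec.const _) Primrec.id) ho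
      ?_ hx hlow
    rw [horel]
    cases (Nat.find hex).bodd <;> assumption
  have hodd : ∀ w, P w → w.bodd = true → g n ∈ ceerClosure S := by
    intro w hw hb
    have := (hP w).1 hw
    rw [hb, cond_true] at this
    exact (hhC _).2 ((hRC _).2 ⟨_, this⟩)
  constructor
  · intro hn
    obtain ⟨x, hx⟩ := (hRC n).1 hn
    obtain ⟨w, hw, heq⟩ := hleast (Nat.bit false x) ((hP _).2 (by
      rw [Nat.bodd_bit, Nat.div2_bit]; exact hx))
    cases hb : w.bodd
    · rw [hb] at heq
      exact mem_ceerClosure_of_ceerEquiv heq hiS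
    · exact hodd w hw hb
  · intro hn
    obtain ⟨x, hx⟩ := (hRC _).1 ((hhC _).1 hn)
    obtain ⟨w, hw, heq⟩ := hleast (Nat.bit true x) ((hP _).2 (by
      rw [Nat.bodd_bit, Nat.div2_bit]; exact hx))
    cases hb : w.bodd
    · have := (hP w).1 hw
      rw [hb, cond_false] at this
      exact (hRC n).2 ⟨_, this⟩
    · rw [hb] at heq
      exact absurd (mem_ceerClosure_of_ceerEquiv ⟨heq.2, heq.1⟩ hn) hjS

/-- If `S` is proper on the infinite ceers and `C` is Σ⁰₃-complete, then `[S] ≤ₘ C`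
implies `C ≤₁ [S]`; in particular neither `[S] <ₘ C` nor `[S] <₁ C` can hold. -/
theorem ceerClosure_not_strictly_below_Sigma03Complete (S C : Set ℕ)
    (hproper : ProperOnInfiniteCeers S) (hC : IsSigma03 C)
    (hCcomplete : ∀ A : Set ℕ, IsSigma03 A → (· ∈ A) ≤₀ (· ∈ C)) :
    ((· ∈ ceerClosure S) ≤₀ (· ∈ C) → (· ∈ C) ≤₁ (· ∈ ceerClosure S)) ∧
      ¬((· ∈ ceerClosure S) ≤₀ (· ∈ C) ∧ ¬(· ∈ C) ≤₀ (· ∈ ceerClosure S)) ∧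
      ¬((· ∈ ceerClosure S) ≤₁ (· ∈ C) ∧ ¬(· ∈ C) ≤₁ (· ∈ ceerClosure S)) := by
  have key := oneOneReducible_ceerClosure (S := S) hproper hC
  exact ⟨key, fun h => h.2 (key h.1).to_many_one, fun h => h.2 (key h.1.to_many_one)⟩
end

section
/- The set {i ∈ ℕ : E_i is computably equivalent to the word problem of some finitely presented group} is Σ⁰₃-complete: it is Σ⁰₃ and every Σ⁰₃ subset of ℕ many-one reduces to it. -/
/-- Code of an element of the free group on `Fin k`, via its reduced word. -/
def encodeFG {k : ℕ} (g : FreeGroup (Fin k)) : ℕ := Encodable.encode g.toWord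

/-- The relator set of the `e`-th c.e. presentation on `k` generators: the set of elements
of the free group on `k` generators whose codes lie in `W e`.  The presented group
`⟨x₁,…,x_k ∣ relSet k e⟩` is `PresentedGroup (relSet k e)`, the quotient of the free group
by the normal closure of this set. -/
def relSet (k e : ℕ) : Set (FreeGroup (Fin k)) := {g | encodeFG g ∈ W e}

/-- Decode a natural number as an element of the free group on `k` generators
(codes of words; non-codes decode to the empty word). -/
def decodeWord (k : ℕ) (m : ℕ) : FreeGroup (Fin k) :=
  FreeGroup.mk ((Encodable.decode (α := List (Fin k × Bool)) m).getD [])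

/-- The word problem of the group `⟨x₁,…,x_k ∣ R⟩`: the equivalence relation on `ℕ`
identifying codes of words whose images in the presented group coincide. -/
def wordProblem (k : ℕ) (R : Set (FreeGroup (Fin k))) : ℕ → ℕ → Prop := fun m n =>
  PresentedGroup.mk R (decodeWord k m) = PresentedGroup.mk R (decodeWord k n)

/-- The set of indices `i` such that `E_i` is computably equivalent to the word problem
of some finitely presented group `⟨x₁,…,x_k ∣ R⟩` (`R` finite). -/
def FPWordProblemIndices : Set ℕ :=
  {i | ∃ (k : ℕ) (R : Finset (FreeGroup (Fin k))), CeerEquiv (ceer i) (wordProblem k ↑R)}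

section SigmaOne

variable {α β γ : Type*} [Primcodable α] [Primcodable β] [Primcodable γ]

/-- `p` is semidecidable: it is the projection of a computable relation. -/
def SigmaOne (p : α → Prop) : Prop :=
  ∃ f : α → ℕ → Bool, Computable₂ f ∧ ∀ a, p a ↔ ∃ n, f a n = true

/-- `p` has the form `∀ y, ∃ z, f a y z` with `f` computable. -/
def PiTwo (p : α → Prop) : Prop :=
  ∃ f : α × ℕ → ℕ → Bool, Computable₂ f ∧ ∀ a, p a ↔ ∀ y, ∃ z, f (a, y) z = true

theorem computable_and {f g : α → Bool} (hf : Computable f) (hg : Computable g) :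
    Computable fun a => f a && g a :=
  (Primrec.and.to_comp.comp hf hg :)

theorem computable_or {f g : α → Bool} (hf : Computable f) (hg : Computable g) :
    Computable fun a => f a || g a :=
  (Primrec.or.to_comp.comp hf hg :)

theorem computable_decide_eq [DecidableEq β] {f g : α → β}
    (hf : Computable f) (hg : Computable g) : Computable fun a => decide (f a = g a) :=
  ((Primrec.eq (α := β)).decide.to_comp.comp hf hg :)

theorem computable_decide_lt {f g : α → ℕ}
    (hf : Computable f) (hg : Computable g) : Computable fun a => decide (f a < g a) :=
  (Primrec.nat_lt.decide.to_comp.comp hf hg :)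

theorem computable_unpair_fst : Computable fun n : ℕ => n.unpair.1 :=
  Computable.fst.comp Computable.unpair

theorem computable_unpair_snd : Computable fun n : ℕ => n.unpair.2 :=
  Computable.snd.comp Computable.unpair

theorem computable_bounded_all {f : α × ℕ → Bool} (hf : Computable f) :
    Computable₂ fun (a : α) (t : ℕ) =>
      (Nat.rec true (fun y ih => ih && f (a, y)) t : Bool) := by
  refine Computable.nat_rec (f := fun x : α × ℕ => x.2) (g := fun _ => true)
    (h := fun x y => y.2 && f (x.1, y.1)) Computable.snd (Computable.const _) ?_
  refine computable_and (Computable.snd.comp Computable.snd) (hf.comp (Computable.pair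
    (Computable.fst.comp Computable.fst) (Computable.fst.comp Computable.snd)))

theorem bounded_all_iff (p : ℕ → Bool) (t : ℕ) :
    (Nat.rec true (fun y ih => ih && p y) t : Bool) = true ↔ ∀ y < t, p y = true := by
  induction t with
  | zero => simp
  | succ t ih =>
    simp only [Bool.and_eq_true, ih, Nat.lt_succ_iff_lt_or_eq]
    exact ⟨fun h y hy => hy.elim (h.1 y) fun e => e ▸ h.2,
      fun h => ⟨fun y hy => h y (Or.inl hy), h t (Or.inr rfl)⟩⟩

theorem computable_bounded_ex {f : α × ℕ → Bool} (hf : Computable f) :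
    Computable₂ fun (a : α) (t : ℕ) =>
      (Nat.rec false (fun y ih => ih || f (a, y)) t : Bool) := by
  refine Computable.nat_rec (f := fun x : α × ℕ => x.2) (g := fun _ => false)
    (h := fun x y => y.2 || f (x.1, y.1)) Computable.snd (Computable.const _) ?_
  refine computable_or (Computable.snd.comp Computable.snd) (hf.comp (Computable.pair
    (Computable.fst.comp Computable.fst) (Computable.fst.comp Computable.snd)))

theorem bounded_ex_iff (p : ℕ → Bool) (t : ℕ) :
    (Nat.rec false (fun y ih => ih || p y) t : Bool) = true ↔ ∃ y < t, p y = true := by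
  induction t with
  | zero => simp
  | succ t ih =>
    simp only [Bool.or_eq_true, ih, Nat.lt_succ_iff_lt_or_eq]
    constructor
    · rintro (⟨y, hy, h⟩ | h)
      exacts [⟨y, Or.inl hy, h⟩, ⟨t, Or.inr rfl, h⟩]
    · rintro ⟨y, hy | rfl, h⟩
      exacts [Or.inl ⟨y, hy, h⟩, Or.inr h]

namespace SigmaOne

theorem of_eq {p q : α → Prop} (hp : SigmaOne p) (h : ∀ a, p a ↔ q a) : SigmaOne q :=
  funext (fun a => propext (h a)) ▸ hp

theorem of_computable {f : α → Bool} (hf : Computable f) : SigmaOne fun a => f a = true :=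
  ⟨fun a _ => f a, hf.comp Computable.fst, fun a => by simp⟩

theorem eq [DecidableEq β] {f g : α → β} (hf : Computable f) (hg : Computable g) :
    SigmaOne fun a => f a = g a :=
  (of_computable (computable_decide_eq hf hg)).of_eq fun a => by simp

theorem lt {f g : α → ℕ} (hf : Computable f) (hg : Computable g) :
    SigmaOne fun a => f a < g a :=
  (of_computable (computable_decide_lt hf hg)).of_eq fun a => by simp

theorem comp {p : β → Prop} (hp : SigmaOne p) {g : α → β} (hg : Computable g) :
    SigmaOne fun a => p (g a) := by
  obtain ⟨f, hf, h⟩ := hp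
  exact ⟨fun a n => f (g a) n, hf.comp (hg.comp Computable.fst) Computable.snd, fun a => h _⟩

theorem exists_nat {p : α × ℕ → Prop} (hp : SigmaOne p) : SigmaOne fun a => ∃ n, p (a, n) := by
  obtain ⟨f, hf, h⟩ := hp
  refine ⟨fun a n => f (a, n.unpair.1) n.unpair.2, ?_, fun a => ?_⟩
  · exact hf.comp (Computable.pair Computable.fst (computable_unpair_fst.comp Computable.snd))
      (computable_unpair_snd.comp Computable.snd)
  · simp only [h]
    constructor
    · rintro ⟨n, m, hm⟩
      exact ⟨Nat.pair n m, by simpa using hm⟩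
    · rintro ⟨n, hn⟩
      exact ⟨_, _, hn⟩

theorem and {p q : α → Prop} (hp : SigmaOne p) (hq : SigmaOne q) :
    SigmaOne fun a => p a ∧ q a := by
  obtain ⟨f, hf, h⟩ := hp
  obtain ⟨g, hg, h'⟩ := hq
  refine ⟨fun a n => f a n.unpair.1 && g a n.unpair.2, ?_, fun a => ?_⟩
  · exact computable_and (hf.comp Computable.fst (computable_unpair_fst.comp Computable.snd))
      (hg.comp Computable.fst (computable_unpair_snd.comp Computable.snd))
  · simp only [h, h', Bool.and_eq_true]
    constructor
    · rintro ⟨⟨n, hn⟩, m, hm⟩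
      exact ⟨Nat.pair n m, by simpa using ⟨hn, hm⟩⟩
    · rintro ⟨n, hn, hm⟩
      exact ⟨⟨_, hn⟩, _, hm⟩

theorem or {p q : α → Prop} (hp : SigmaOne p) (hq : SigmaOne q) :
    SigmaOne fun a => p a ∨ q a := by
  obtain ⟨f, hf, h⟩ := hp
  obtain ⟨g, hg, h'⟩ := hq
  refine ⟨fun a n => f a n || g a n, computable_or hf hg, fun a => ?_⟩
  simp only [h, h', Bool.or_eq_true, exists_or]

theorem exists_code {p : α × β → Prop} (hp : SigmaOne p) : SigmaOne fun a => ∃ b, p (a, b) := by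
  obtain ⟨f, hf, h⟩ := hp
  have key : SigmaOne fun x : (α × ℕ) × ℕ =>
      (Encodable.decode (α := β) x.1.2).casesOn (motive := fun _ => Bool) false
        (fun b => f (x.1.1, b) x.2) = true := by
    refine of_computable (Computable.option_casesOn (Computable.decode.comp
      (Computable.snd.comp Computable.fst)) (Computable.const false) ?_)
    exact hf.comp (Computable.pair (Computable.fst.comp (Computable.fst.comp Computable.fst))
      Computable.snd) (Computable.snd.comp Computable.fst)
  refine key.exists_nat.exists_nat.of_eq fun a => ?_
  constructor
  · rintro ⟨m, n, hn⟩
    cases hd : Encodable.decode (α := β) m with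
    | none => simp [hd] at hn
    | some b => exact ⟨b, (h _).2 ⟨n, by simpa [hd] using hn⟩⟩
  · rintro ⟨b, hb⟩
    obtain ⟨n, hn⟩ := (h _).1 hb
    exact ⟨Encodable.encode b, n, by simpa using hn⟩

theorem forall_lt {p : α × ℕ → Prop} (hp : SigmaOne p) {b : α → ℕ} (hb : Computable b) :
    SigmaOne fun a => ∀ y < b a, p (a, y) := by
  obtain ⟨f, hf, h⟩ := hp
  have h1 := computable_bounded_ex (α := α × ℕ) (f := fun x => f x.1 x.2) hf
  have h2 : Computable fun x : (α × ℕ) × ℕ =>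
      (Nat.rec false (fun y ih => ih || f (x.1.1, x.2) y) x.1.2 : Bool) :=
    h1.comp (Computable.pair (Computable.fst.comp Computable.fst) Computable.snd)
      (Computable.snd.comp Computable.fst)
  have h3 := computable_bounded_all h2
  refine (of_computable (h3.comp (Computable.id (α := α × ℕ))
    (hb.comp Computable.fst))).exists_nat.of_eq fun a => ?_
  simp only [bounded_all_iff, bounded_ex_iff, h, id]
  constructor
  · rintro ⟨N, hN⟩ y hy
    obtain ⟨n, -, hn⟩ := hN y hy
    exact ⟨n, hn⟩
  · intro H
    choose g hg using H
    refine ⟨(Finset.range (b a)).sup (fun y => if hy : y < b a then g y hy + 1 else 0),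
      fun y hy => ⟨g y hy, ?_, hg y hy⟩⟩
    have := Finset.le_sup (f := fun y => if hy : y < b a then g y hy + 1 else 0)
      (Finset.mem_range.2 hy)
    simp only [hy, dif_pos] at this
    exact this

end SigmaOne

/-- The equivalence closure consists of the pairs joined by a zigzag path. -/
theorem eqvGen_iff_exists_path {δ : Type*} [Inhabited δ] {r : δ → δ → Prop} {a b : δ} :
    Relation.EqvGen r a b ↔ ∃ l : List δ, ∃ n, l.getD 0 default = a ∧ l.getD n default = b ∧
      ∀ i < n, r (l.getD i default) (l.getD (i + 1) default) ∨
        r (l.getD (i + 1) default) (l.getD i default) := by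
  constructor
  · intro h
    have h' : Relation.ReflTransGen (fun x y => r x y ∨ r y x) a b := by
      induction h with
      | rel _ _ h => exact .single (Or.inl h)
      | refl => exact .refl
      | symm _ _ _ ih =>
        have : Std.Symm fun x y => r x y ∨ r y x := ⟨fun _ _ => Or.symm⟩
        exact Relation.ReflTransGen.stdSymm.symm _ _ ih
      | trans _ _ _ _ _ ih₁ ih₂ => exact ih₁.trans ih₂
    have h'' : ∃ f : ℕ → δ, ∃ n, f 0 = a ∧ f n = b ∧
        ∀ i < n, r (f i) (f (i + 1)) ∨ r (f (i + 1)) (f i) := by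
      clear h
      induction h' with
      | refl => exact ⟨fun _ => a, 0, rfl, rfl, by simp⟩
      | @tail x y _ hxy ih =>
        obtain ⟨f, n, h0, hn, hf⟩ := ih
        refine ⟨fun i => if i ≤ n then f i else y, n + 1, by simpa, by simp, fun i hi => ?_⟩
        rcases Nat.lt_succ_iff_lt_or_eq.1 hi with hi | rfl
        · simpa [hi.le, Nat.succ_le_of_lt hi] using hf i hi
        · simpa [hn] using hxy
    obtain ⟨f, n, h0, hn, hf⟩ := h''
    have key : ∀ i ≤ n, ((List.range (n + 1)).map f).getD i default = f i := fun i hi => by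
      simp [List.getD, List.getElem?_range (Nat.lt_succ_of_le hi)]
    refine ⟨(List.range (n + 1)).map f, n, by rw [key 0 (Nat.zero_le _), h0],
      by rw [key n le_rfl, hn], fun i hi => ?_⟩
    rw [key i hi.le, key (i + 1) hi]
    exact hf i hi
  · rintro ⟨l, n, rfl, rfl, h⟩
    induction n with
    | zero => exact .refl _
    | succ n ih =>
      refine (ih fun i hi => h i (Nat.lt_succ_of_lt hi)).trans _ _ _ ?_
      rcases h n (Nat.lt_succ_self n) with h | h
      exacts [.rel _ _ h, .symm _ _ (.rel _ _ h)]

theorem computable_list_getD [Inhabited β] {l : α → List β} {n : α → ℕ} (hl : Computable l)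
    (hn : Computable n) : Computable fun a => (l a).getD (n a) default :=
  Computable.option_getD (Computable.list_getElem?.comp hl hn) (Computable.const default)

theorem SigmaOne.eqvGen [Inhabited β] [DecidableEq β] {r : γ → β → β → Prop}
    (hr : SigmaOne fun x : γ × β × β => r x.1 x.2.1 x.2.2) :
    SigmaOne fun x : γ × β × β => Relation.EqvGen (r x.1) x.2.1 x.2.2 := by
  have hl : Computable fun x : ((γ × β × β) × List β) × ℕ => x.1.2 :=
    Computable.snd.comp Computable.fst
  have hx : Computable fun x : ((γ × β × β) × List β) × ℕ => x.1.1 :=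
    Computable.fst.comp Computable.fst
  have h1 := SigmaOne.eq (computable_list_getD hl (Computable.const 0))
    (Computable.fst.comp (Computable.snd.comp hx))
  have h2 := SigmaOne.eq (computable_list_getD hl Computable.snd)
    (Computable.snd.comp (Computable.snd.comp hx))
  have hc : Computable fun x : (((γ × β × β) × List β) × ℕ) × ℕ => x.1.1.1.1 :=
    Computable.fst.comp (hx.comp Computable.fst)
  have hi := computable_list_getD (hl.comp Computable.fst)
    (Computable.snd (α := ((γ × β × β) × List β) × ℕ) (β := ℕ))
  have hj := computable_list_getD (hl.comp Computable.fst)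
    (Computable.succ.comp (Computable.snd (α := ((γ × β × β) × List β) × ℕ) (β := ℕ)))
  have h3 := ((hr.comp (hc.pair (hi.pair hj))).or (hr.comp (hc.pair (hj.pair hi)))).forall_lt
    (Computable.snd (α := (γ × β × β) × List β) (β := ℕ))
  exact ((h1.and (h2.and h3)).exists_code.exists_code).of_eq fun x =>
    (eqvGen_iff_exists_path (r := r x.1) (a := x.2.1) (b := x.2.2)).symm

namespace PiTwo

theorem of_eq {p q : α → Prop} (hp : PiTwo p) (h : ∀ a, p a ↔ q a) : PiTwo q :=
  funext (fun a => propext (h a)) ▸ hp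

theorem _root_.SigmaOne.piTwo {p : α → Prop} (hp : SigmaOne p) : PiTwo p := by
  obtain ⟨f, hf, h⟩ := hp
  exact ⟨fun x z => f x.1 z, hf.comp (Computable.fst.comp Computable.fst) Computable.snd,
    fun a => by simp [h]⟩

theorem _root_.SigmaOne.imp {p q : α → Prop} (hp : SigmaOne p) (hq : SigmaOne q) :
    PiTwo fun a => p a → q a := by
  obtain ⟨f, hf, h⟩ := hp
  obtain ⟨g, hg, h'⟩ := hq
  refine ⟨fun x z => !f x.1 x.2 || g x.1 z, ?_, fun a => ?_⟩
  · exact computable_or (Primrec.not.to_comp.comp (hf.comp (Computable.fst.comp Computable.fst)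
      (Computable.snd.comp Computable.fst))) (hg.comp (Computable.fst.comp Computable.fst)
      Computable.snd)
  · simp only [h, h', Bool.or_eq_true, Bool.not_eq_true']
    constructor
    · intro H y
      cases hy : f a y with
      | false => exact ⟨0, Or.inl rfl⟩
      | true => exact (H ⟨y, hy⟩).imp fun _ => Or.inr
    · rintro H ⟨y, hy⟩
      obtain ⟨z, hz⟩ := H y
      exact ⟨z, hz.resolve_left (by simp [hy])⟩

theorem and {p q : α → Prop} (hp : PiTwo p) (hq : PiTwo q) : PiTwo fun a => p a ∧ q a := by
  obtain ⟨f, hf, h⟩ := hp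
  obtain ⟨g, hg, h'⟩ := hq
  refine ⟨fun x z => f x z.unpair.1 && g x z.unpair.2, ?_, fun a => ?_⟩
  · exact computable_and (hf.comp Computable.fst (computable_unpair_fst.comp Computable.snd))
      (hg.comp Computable.fst (computable_unpair_snd.comp Computable.snd))
  · simp only [h, h', Bool.and_eq_true, ← forall_and]
    refine forall_congr' fun y => ⟨?_, ?_⟩
    · rintro ⟨⟨n, hn⟩, m, hm⟩
      exact ⟨Nat.pair n m, by simpa using ⟨hn, hm⟩⟩
    · rintro ⟨n, hn, hm⟩
      exact ⟨⟨_, hn⟩, _, hm⟩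

theorem forall_code {p : α × β → Prop} (hp : PiTwo p) : PiTwo fun a => ∀ b, p (a, b) := by
  obtain ⟨f, hf, h⟩ := hp
  refine ⟨fun x z => (Encodable.decode (α := β) x.2.unpair.1).casesOn (motive := fun _ => Bool)
    true (fun b => f ((x.1, b), x.2.unpair.2) z), ?_, fun a => ?_⟩
  · refine Computable.option_casesOn (Computable.decode.comp (computable_unpair_fst.comp
      (Computable.snd.comp Computable.fst))) (Computable.const true) ?_
    exact hf.comp (Computable.pair (Computable.pair (Computable.fst.comp
      (Computable.fst.comp Computable.fst)) Computable.snd)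
      (computable_unpair_snd.comp (Computable.snd.comp (Computable.fst.comp Computable.fst))))
      (Computable.snd.comp Computable.fst)
  · simp only [h]
    constructor
    · intro H y
      cases hd : Encodable.decode (α := β) y.unpair.1 with
      | none => simp
      | some b => exact H b _
    · intro H b y
      simpa using H (Nat.pair (Encodable.encode b) y)

theorem isSigma03 {p : ℕ × β → Prop} (hp : PiTwo p) : IsSigma03 {n | ∃ b, p (n, b)} := by
  obtain ⟨f, hf, h⟩ := hp
  refine ⟨fun n x y z => (Encodable.decode (α := β) x).casesOn (motive := fun _ => Bool)
    false (fun b => f ((n, b), y) z), ?_, fun n => ?_⟩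
  · refine Computable.option_casesOn (Computable.decode.comp
      (Computable.fst.comp Computable.snd)) (Computable.const false) ?_
    have h1 : Computable fun q : (ℕ × ℕ × ℕ × ℕ) × β => q.1.2.2 :=
      Computable.snd.comp (Computable.snd.comp Computable.fst)
    exact hf.comp (Computable.pair (Computable.pair (Computable.fst.comp Computable.fst)
      Computable.snd) (Computable.fst.comp h1)) (Computable.snd.comp h1)
  · simp only [Set.mem_ofPred_eq, h]
    constructor
    · rintro ⟨b, hb⟩
      exact ⟨Encodable.encode b, by simpa using hb⟩
    · rintro ⟨x, hx⟩
      cases hd : Encodable.decode (α := β) x with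
      | none => simp [hd] at hx
      | some b => exact ⟨b, fun y => by simpa [hd] using hx y⟩

end PiTwo

end SigmaOne

open Nat.Partrec (Code)

theorem sigmaOne_mem_eval : SigmaOne fun x : Code × ℕ × ℕ => x.2.2 ∈ x.1.eval x.2.1 := by
  have h : Computable fun x : (Code × ℕ × ℕ) × ℕ => Code.evaln x.2 x.1.1 x.1.2.1 :=
    Code.primrec_evaln.to_comp.comp (Computable.pair (Computable.pair Computable.snd
      (Computable.fst.comp Computable.fst))
      (Computable.fst.comp (Computable.snd.comp Computable.fst)))
  exact (SigmaOne.eq h (Computable.option_some.comp (Computable.snd.comp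
    (Computable.snd.comp Computable.fst)))).exists_nat.of_eq fun x =>
    (Code.evaln_complete (c := x.1) (n := x.2.1) (x := x.2.2)).symm

theorem sigmaOne_mem_W : SigmaOne fun x : ℕ × ℕ => x.2 ∈ W x.1 := by
  have h : Computable fun x : (ℕ × ℕ) × ℕ => (Denumerable.ofNat Code x.1.1, x.1.2, x.2) :=
    ((Computable.ofNat Code).comp (Computable.fst.comp Computable.fst)).pair
      ((Computable.snd.comp Computable.fst).pair Computable.snd)
  exact (sigmaOne_mem_eval.comp h).exists_nat.of_eq fun x =>
    (Part.dom_iff_mem (o := (Denumerable.ofNat Code x.1).eval x.2)).symm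

theorem sigmaOne_ceer : SigmaOne fun x : ℕ × ℕ × ℕ => ceer x.1 x.2.1 x.2.2 :=
  SigmaOne.eqvGen (r := fun i m n => Nat.pair m n ∈ W i) <| sigmaOne_mem_W.comp
    (Computable.fst.pair (Primrec₂.natPair.to_comp.comp (Computable.fst.comp Computable.snd)
      (Computable.snd.comp Computable.snd)))

/-- A uniformly semidecidable family of sets has computable c.e. indices. -/
theorem SigmaOne.exists_index {p : ℕ × ℕ → Prop} (hp : SigmaOne p) :
    ∃ f : ℕ → ℕ, Computable f ∧ ∀ n m, m ∈ W (f n) ↔ p (n, m) := by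
  obtain ⟨g, hg, h⟩ := hp
  have hpart : Partrec fun e : ℕ => Nat.rfind fun k => Part.some (g e.unpair k) :=
    Partrec.rfind (hg.comp (Computable.unpair.comp Computable.fst) Computable.snd).partrec
  obtain ⟨c, hc⟩ := Code.exists_code.1 (Partrec.nat_iff.1 hpart)
  refine ⟨fun n => Encodable.encode (c.curry n), Computable.encode.comp
    (Code.primrec₂_curry.to_comp.comp (Computable.const c) Computable.id), fun n m => ?_⟩
  change Part.Dom _ ↔ _
  rw [Denumerable.ofNat_encode, Code.eval_curry, hc, h]
  simp only [Nat.unpair_pair]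
  refine Nat.rfind_dom'.trans ⟨fun ⟨k, hk, _⟩ => ⟨k, (Part.mem_some_iff.1 hk).symm⟩,
    fun ⟨k, hk⟩ => ⟨k, Part.mem_some_iff.2 hk.symm, fun _ => trivial⟩⟩

/-- The total function computed by `c` is a reduction of `E` to `F`. -/
def ReducesVia (c : Code) (E F : ℕ → ℕ → Prop) : Prop :=
  (∀ m, ∃ u, u ∈ c.eval m) ∧ ∀ q : (ℕ × ℕ) × ℕ × ℕ,
    ((q.2.1 ∈ c.eval q.1.1 ∧ q.2.2 ∈ c.eval q.1.2) ∧ E q.1.1 q.1.2 → F q.2.1 q.2.2) ∧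
    ((q.2.1 ∈ c.eval q.1.1 ∧ q.2.2 ∈ c.eval q.1.2) ∧ F q.2.1 q.2.2 → E q.1.1 q.1.2)

theorem computableReduction_iff {E F : ℕ → ℕ → Prop} :
    ComputableReduction E F ↔ ∃ c, ReducesVia c E F := by
  constructor
  · rintro ⟨Φ, hΦ, h⟩
    obtain ⟨c, hc⟩ := Code.exists_code.1 (Partrec.nat_iff.1 hΦ.partrec)
    have hm : ∀ u m, u ∈ c.eval m ↔ u = Φ m := fun u m => by simp [hc]
    refine ⟨c, fun m => ⟨_, (hm _ m).2 rfl⟩, fun ⟨⟨m, n⟩, u, v⟩ => ⟨?_, ?_⟩⟩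
    · rintro ⟨⟨h1, h2⟩, h3⟩
      dsimp only at *
      rw [(hm _ _).1 h1, (hm _ _).1 h2]
      exact (h _ _).1 h3
    · rintro ⟨⟨h1, h2⟩, h3⟩
      dsimp only at *
      rw [(hm _ _).1 h1, (hm _ _).1 h2] at h3
      exact (h _ _).2 h3
  · rintro ⟨c, ht, h⟩
    choose Φ hΦ using ht
    exact ⟨Φ, Partrec.of_eq_tot (Partrec.nat_iff.2 (Code.exists_code.2 ⟨c, rfl⟩)) hΦ,
      fun m n => ⟨fun hE => (h ((m, n), Φ m, Φ n)).1 ⟨⟨hΦ m, hΦ n⟩, hE⟩,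
        fun hF => (h ((m, n), Φ m, Φ n)).2 ⟨⟨hΦ m, hΦ n⟩, hF⟩⟩⟩

theorem piTwo_reducesVia {α : Type*} [Primcodable α] {E F : α → ℕ → ℕ → Prop}
    (hE : SigmaOne fun x : α × ℕ × ℕ => E x.1 x.2.1 x.2.2)
    (hF : SigmaOne fun x : α × ℕ × ℕ => F x.1 x.2.1 x.2.2) {c : α → Code} (hc : Computable c) :
    PiTwo fun a => ReducesVia (c a) (E a) (F a) := by
  have h1 : SigmaOne fun x : (α × ℕ) × ℕ => x.2 ∈ (c x.1.1).eval x.1.2 :=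
    sigmaOne_mem_eval.comp ((hc.comp (Computable.fst.comp Computable.fst)).pair
      ((Computable.snd.comp Computable.fst).pair Computable.snd))
  have hc' : Computable fun x : α × (ℕ × ℕ) × ℕ × ℕ => c x.1 := hc.comp Computable.fst
  have ha : Computable fun x : α × (ℕ × ℕ) × ℕ × ℕ => x.1 := Computable.fst
  have hm : Computable fun x : α × (ℕ × ℕ) × ℕ × ℕ => x.2.1 :=
    Computable.fst.comp Computable.snd
  have hu : Computable fun x : α × (ℕ × ℕ) × ℕ × ℕ => x.2.2 :=
    Computable.snd.comp Computable.snd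
  have h2 := (sigmaOne_mem_eval.comp (hc'.pair ((Computable.fst.comp hm).pair
    (Computable.fst.comp hu)))).and (sigmaOne_mem_eval.comp
      (hc'.pair ((Computable.snd.comp hm).pair (Computable.snd.comp hu))))
  have hE' := hE.comp (ha.pair hm)
  have hF' := hF.comp (ha.pair hu)
  exact h1.exists_nat.piTwo.forall_code.and
    (((h2.and hE').imp hF').and ((h2.and hF').imp hE')).forall_code

/-- One rewriting step: insertion of a word from `S` or of a trivial word `x x⁻¹`. -/
def InsertStep {α : Type*} (S : List (α × Bool) → Prop) (a b : List (α × Bool)) : Prop :=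
  ∃ q : (List (α × Bool) × List (α × Bool)) × List (α × Bool),
    (a = q.1.1 ++ q.1.2 ∧ b = q.1.1 ++ (q.2 ++ q.1.2)) ∧
      (S q.2 ∨ ∃ x : α × Bool, q.2 = [x, (x.1, !x.2)])

section InsertStep

variable {α : Type*} {S : List (α × Bool) → Prop}

open Relation
open FreeGroup (mk invRev mul_mk inv_mk)

theorem EqvGen.insertStep_append {a b : List (α × Bool)} (u v : List (α × Bool))
    (h : EqvGen (InsertStep S) a b) : EqvGen (InsertStep S) (u ++ (a ++ v)) (u ++ (b ++ v)) := by
  induction h with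
  | rel a b h =>
    obtain ⟨⟨⟨p, q⟩, r⟩, ⟨rfl, rfl⟩, h⟩ := h
    exact .rel _ _ ⟨⟨⟨u ++ p, q ++ v⟩, r⟩, ⟨by simp, by simp⟩, h⟩
  | refl => exact .refl _
  | symm _ _ _ ih => exact ih.symm
  | trans _ _ _ _ _ ih₁ ih₂ => exact ih₁.trans _ _ _ ih₂

theorem eqvGen_insertStep_of_mk_eq {a b : List (α × Bool)} (h : mk a = mk b) :
    EqvGen (InsertStep S) a b := by
  refine .symm _ _ ?_
  have h' : EqvGen FreeGroup.Red.Step b a := Quot.eqvGen_exact h.symm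
  clear h
  induction h' with
  | rel x y h =>
    obtain @⟨u, v, x, b⟩ := h
    exact .symm _ _ (.rel _ _ ⟨⟨⟨u, v⟩, [(x, b), (x, !b)]⟩, ⟨rfl, by simp⟩, Or.inr ⟨_, rfl⟩⟩)
  | refl => exact .refl _
  | symm _ _ _ ih => exact ih.symm
  | trans _ _ _ _ _ ih₁ ih₂ => exact ih₁.trans _ _ _ ih₂

/-- The elements of the free group all of whose words rewrite to the empty word. -/
def insertStepKernel (S : List (α × Bool) → Prop) : Subgroup (FreeGroup α) where
  carrier := {g | ∀ w, mk w = g → EqvGen (InsertStep S) w []}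
  one_mem' _ hw := eqvGen_insertStep_of_mk_eq hw
  mul_mem' {g h} hg hh w hw := by
    obtain ⟨a, rfl⟩ := Quot.exists_rep g
    obtain ⟨b, rfl⟩ := Quot.exists_rep h
    refine (eqvGen_insertStep_of_mk_eq (b := a ++ b) (hw.trans mul_mk)).trans _ _ _ ?_
    exact (EqvGen.insertStep_append [] b (hg a rfl)).trans _ _ _ (hh b rfl)
  inv_mem' {g} hg w hw := by
    obtain ⟨a, rfl⟩ := Quot.exists_rep g
    have h := EqvGen.insertStep_append w [] (hg a rfl)
    simp only [List.append_nil] at h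
    refine h.symm.trans _ _ _ (eqvGen_insertStep_of_mk_eq ?_)
    rw [← mul_mk, hw]
    exact inv_mul_cancel (mk a)

instance insertStepKernel_normal : (insertStepKernel S).Normal where
  conj_mem g hg c w hw := by
    obtain ⟨a, rfl⟩ := Quot.exists_rep g
    obtain ⟨u, rfl⟩ := Quot.exists_rep c
    refine (eqvGen_insertStep_of_mk_eq (b := u ++ (a ++ invRev u)) ?_).trans _ _ _
      ((EqvGen.insertStep_append u (invRev u) (hg a rfl)).trans _ _ _
        (eqvGen_insertStep_of_mk_eq ?_))
    · rw [hw, ← mul_mk, ← mul_mk, ← inv_mk, ← mul_assoc]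
      rfl
    · rw [List.nil_append, ← mul_mk, ← inv_mk]
      exact mul_inv_cancel (mk u)

theorem presentedGroup_mk_eq_iff {a b : List (α × Bool)} :
    PresentedGroup.mk {g | ∃ r, S r ∧ mk r = g} (mk a) =
      PresentedGroup.mk {g | ∃ r, S r ∧ mk r = g} (mk b) ↔ EqvGen (InsertStep S) a b := by
  constructor
  · intro h
    have h1 : mk (a ++ invRev b) ∈ Subgroup.normalClosure {g | ∃ r, S r ∧ mk r = g} := by
      rw [← mul_mk, ← inv_mk, ← PresentedGroup.mk_eq_one_iff, map_mul, map_inv, h,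
        mul_inv_cancel]
    have h2 : Subgroup.normalClosure {g | ∃ r, S r ∧ mk r = g} ≤ insertStepKernel S := by
      refine Subgroup.normalClosure_le_normal ?_
      rintro _ ⟨r, hr, rfl⟩ w hw
      exact (eqvGen_insertStep_of_mk_eq hw).trans _ _ _
        (.symm _ _ (.rel _ _ ⟨⟨⟨[], []⟩, r⟩, ⟨rfl, by simp⟩, Or.inl hr⟩))
    have h3 := EqvGen.insertStep_append [] b (h2 h1 _ rfl)
    refine (eqvGen_insertStep_of_mk_eq ?_).trans _ _ _ h3
    simp only [List.nil_append, ← mul_mk, ← inv_mk, inv_mul_cancel_right]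
  · intro h
    induction h with
    | rel a b h =>
      obtain ⟨⟨⟨p, q⟩, r⟩, ⟨rfl, rfl⟩, h⟩ := h
      have hr : PresentedGroup.mk {g | ∃ r, S r ∧ mk r = g} (mk r) = 1 := by
        rcases h with h | ⟨x, rfl⟩
        · exact PresentedGroup.mk_eq_one_iff.2 (Subgroup.subset_normalClosure ⟨r, h, rfl⟩)
        · rw [show mk [x, (x.1, !x.2)] = (1 : FreeGroup α) from Quot.sound (.not (L₁ := [])),
            map_one]
      simp only [← mul_mk, map_mul, hr, one_mul]
    | refl => rfl
    | symm _ _ _ ih => exact ih.symm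
    | trans _ _ _ _ _ ih₁ ih₂ => exact ih₁.trans ih₂

end InsertStep

/-- The word over the alphabet `ℕ` coded by `m`, or the empty word if some letter is not a
generator of the free group on `k` generators. -/
def decodeNatWord (k m : ℕ) : List (ℕ × Bool) :=
  let l := (Encodable.decode (α := List (ℕ × Bool)) m).getD []
  if ∀ x ∈ l, x.1 < k then l else []

theorem computable_decodeNatWord : Computable₂ decodeNatWord := by
  have h1 : Primrec fun x : ℕ × ℕ => (Encodable.decode (α := List (ℕ × Bool)) x.2).getD [] :=
    Primrec.option_getD.comp (Primrec.decode.comp Primrec.snd) (Primrec.const [])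
  have h2 : PrimrecRel fun (y : ℕ × Bool) (k : ℕ) => y.1 < k :=
    Primrec.nat_lt.comp₂ (Primrec.fst.comp₂ Primrec₂.left) Primrec₂.right
  exact (Primrec.ite (h2.forall_mem_list.comp h1 Primrec.fst) h1 (Primrec.const [])).to_comp

theorem decode_list_fin (k m : ℕ) :
    (Encodable.decode (α := List (Fin k × Bool)) m).map (List.map (Prod.map Fin.val id)) =
      (Encodable.decode (α := List (ℕ × Bool)) m).filter fun l => ∀ x ∈ l, x.1 < k := by
  induction m using Nat.strong_induction_on with
  | _ m ih =>
    cases m with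
    | zero => simp [Option.filter]
    | succ v =>
      have ih := ih v.unpair.2 (Nat.lt_succ_of_le v.unpair_right_le)
      simp only [Encodable.decode_list_succ, Encodable.decode_prod_val]
      have hf : ∀ n, Encodable.decode (α := Fin k) n = if h : n < k then some ⟨n, h⟩ else none := by
        intro n
        refine (Encodable.decode_ofEquiv Fin.equivSubtype n).trans ?_
        change Option.map _ (Encodable.decodeSubtype n) = _
        by_cases h : n < k <;> simp [Encodable.decodeSubtype, h, Fin.equivSubtype]
      rw [hf]
      cases hb : Encodable.decode (α := Bool) v.unpair.1.unpair.2 with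
      | none => by_cases h : v.unpair.1.unpair.1 < k <;> simp [h, Option.filter, Seq.seq]
      | some b =>
        cases hl : Encodable.decode (α := List (Fin k × Bool)) v.unpair.2 <;>
        cases hl' : Encodable.decode (α := List (ℕ × Bool)) v.unpair.2 <;>
        rw [hl, hl'] at ih <;>
        by_cases h : v.unpair.1.unpair.1 < k <;>
        simp_all [Option.filter, Seq.seq]
        simp [h.not_gt]

theorem map_decodeWord (k m : ℕ) :
    FreeGroup.map Fin.val (decodeWord k m) = FreeGroup.mk (decodeNatWord k m) := by
  have h := decode_list_fin k m
  rw [decodeWord, FreeGroup.map.mk]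
  congr 1
  rw [decodeNatWord]
  change ((Encodable.decode (α := List (Fin k × Bool)) m).getD []).map
    (Prod.map Fin.val id) = _
  cases hf : Encodable.decode (α := List (Fin k × Bool)) m with
  | none =>
    cases h1 : Encodable.decode (α := List (ℕ × Bool)) m with
    | none => simp
    | some l =>
      rw [hf, h1] at h
      have hl : ¬∀ x ∈ l, x.1 < k := by simpa [Option.filter] using h
      simp only [Option.getD_none, Option.getD_some, List.map_nil, if_neg hl]
  | some w =>
    rw [hf, Option.map_some, eq_comm, Option.filter_eq_some_iff] at h
    have hl := of_decide_eq_true h.2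
    simp only [h.1, Option.getD_some, if_pos hl]

theorem map_mem_normalClosure {G H : Type*} [Group G] [Group H] (f : G →* H) {A : Set G}
    {B : Set H} (h : ∀ a ∈ A, f a ∈ B) {x : G} (hx : x ∈ Subgroup.normalClosure A) :
    f x ∈ Subgroup.normalClosure B :=
  (Subgroup.normalClosure_le_normal (N := (Subgroup.normalClosure B).comap f) fun a ha =>
    Subgroup.subset_normalClosure (h a ha)) hx

theorem presentedGroup_mk_eq {α : Type*} {R : Set (FreeGroup α)} {x y : FreeGroup α} :
    PresentedGroup.mk R x = PresentedGroup.mk R y ↔ x⁻¹ * y ∈ Subgroup.normalClosure R :=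
  QuotientGroup.eq

theorem wordProblem_iff_eqvGen (k : ℕ) (R : Set ℕ) (m n : ℕ) :
    wordProblem k (decodeWord k '' R) m n ↔ Relation.EqvGen
      (InsertStep fun w => ∃ c, c ∈ R ∧ w = decodeNatWord k c)
      (decodeNatWord k m) (decodeNatWord k n) := by
  rw [← presentedGroup_mk_eq_iff, ← map_decodeWord, ← map_decodeWord, wordProblem,
    presentedGroup_mk_eq, presentedGroup_mk_eq, ← map_inv, ← map_mul]
  let ρ : FreeGroup ℕ →* FreeGroup (Fin k) :=
    FreeGroup.lift fun j => if h : j < k then FreeGroup.of ⟨j, h⟩ else 1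
  have hρ : ∀ x, ρ (FreeGroup.map Fin.val x) = x := by
    intro x
    have : ρ.comp (FreeGroup.map Fin.val) = MonoidHom.id _ := by
      ext j
      simp [ρ]
    exact DFunLike.congr_fun this x
  constructor
  · refine map_mem_normalClosure _ ?_
    rintro _ ⟨c, hc, rfl⟩
    exact ⟨_, ⟨c, hc, rfl⟩, (map_decodeWord k c).symm⟩
  · intro h
    rw [← hρ (_ * _)]
    refine map_mem_normalClosure ρ ?_ h
    rintro _ ⟨_, ⟨c, hc, rfl⟩, rfl⟩
    rw [← map_decodeWord, hρ]
    exact ⟨c, hc, rfl⟩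

theorem sigmaOne_wordProblem : SigmaOne fun x : (ℕ × List ℕ) × ℕ × ℕ =>
    wordProblem x.1.1 (decodeWord x.1.1 '' {c | c ∈ x.1.2}) x.2.1 x.2.2 := by
  have hmem : SigmaOne fun x : List ℕ × ℕ => x.2 ∈ x.1 :=
    (SigmaOne.eq (Computable.list_getElem?.comp (Computable.fst.comp Computable.fst)
      Computable.snd) (Computable.option_some.comp
        (Computable.snd.comp Computable.fst))).exists_nat.of_eq
      fun x => (List.mem_iff_getElem? (l := x.1) (a := x.2)).symm
  have hrel : SigmaOne fun x : (ℕ × List ℕ) × List (ℕ × Bool) =>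
      ∃ c, c ∈ x.1.2 ∧ x.2 = decodeNatWord x.1.1 c :=
    ((hmem.comp ((Computable.snd.comp (Computable.fst.comp Computable.fst)).pair
      Computable.snd)).and (SigmaOne.eq (Computable.snd.comp Computable.fst)
      (computable_decodeNatWord.comp (Computable.fst.comp (Computable.fst.comp Computable.fst))
        Computable.snd))).exists_nat
  have hinv : Computable fun x : List (ℕ × Bool) × ℕ × Bool =>
      [x.2, (x.2.1, !x.2.2)] :=
    Computable.list_cons.comp Computable.snd (Computable.list_cons.comp
      ((Computable.fst.comp Computable.snd).pair
        (Primrec.not.to_comp.comp (Computable.snd.comp Computable.snd))) (Computable.const []))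
  have htriv : SigmaOne fun r : List (ℕ × Bool) =>
      ∃ x : ℕ × Bool, r = [x, (x.1, !x.2)] :=
    (SigmaOne.eq Computable.fst hinv).exists_code
  have hstep : SigmaOne fun x : (ℕ × List ℕ) × List (ℕ × Bool) × List (ℕ × Bool) =>
      InsertStep (fun w => ∃ c, c ∈ x.1.2 ∧ w = decodeNatWord x.1.1 c) x.2.1 x.2.2 := by
    let X := ((ℕ × List ℕ) × List (ℕ × Bool) × List (ℕ × Bool)) ×
      (List (ℕ × Bool) × List (ℕ × Bool)) × List (ℕ × Bool)
    have hu : Computable fun x : X => x.2.1.1 :=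
      Computable.fst.comp (Computable.fst.comp Computable.snd)
    have hv : Computable fun x : X => x.2.1.2 :=
      Computable.snd.comp (Computable.fst.comp Computable.snd)
    have hr : Computable fun x : X => x.2.2 := Computable.snd.comp Computable.snd
    have ha : Computable fun x : X => x.1.2.1 :=
      Computable.fst.comp (Computable.snd.comp Computable.fst)
    have hb : Computable fun x : X => x.1.2.2 :=
      Computable.snd.comp (Computable.snd.comp Computable.fst)
    have hp : Computable fun x : X => x.1.1 := Computable.fst.comp Computable.fst
    exact (((SigmaOne.eq ha (Computable.list_append.comp hu hv)).and
      (SigmaOne.eq hb (Computable.list_append.comp hu (Computable.list_append.comp hr hv)))).and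
      ((hrel.comp (hp.pair hr)).or (htriv.comp hr))).exists_code
  have hk : Computable fun x : (ℕ × List ℕ) × ℕ × ℕ => x.1.1 :=
    Computable.fst.comp Computable.fst
  refine ((SigmaOne.eqvGen (r := fun (p : ℕ × List ℕ) =>
    InsertStep fun w => ∃ c, c ∈ p.2 ∧ w = decodeNatWord p.1 c) hstep).comp
    (Computable.fst.pair ((computable_decodeNatWord.comp hk
      (Computable.fst.comp Computable.snd)).pair (computable_decodeNatWord.comp hk
        (Computable.snd.comp Computable.snd))))).of_eq fun x => ?_
  exact (wordProblem_iff_eqvGen x.1.1 {c | c ∈ x.1.2} x.2.1 x.2.2).symm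

theorem decodeWord_surjective (k : ℕ) : Function.Surjective (decodeWord k) := fun g => by
  obtain ⟨w, rfl⟩ := Quot.exists_rep g
  exact ⟨Encodable.encode w, by simp [decodeWord, FreeGroup.quot_mk_eq_mk]⟩

theorem mem_FPWordProblemIndices_iff (i : ℕ) : i ∈ FPWordProblemIndices ↔
    ∃ p : (ℕ × List ℕ) × Code × Code,
      ReducesVia p.2.1 (ceer i) (wordProblem p.1.1 (decodeWord p.1.1 '' {c | c ∈ p.1.2})) ∧
      ReducesVia p.2.2 (wordProblem p.1.1 (decodeWord p.1.1 '' {c | c ∈ p.1.2})) (ceer i) := by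
  classical
  have hfin : ∀ k (R : Finset (FreeGroup (Fin k))),
      ∃ L : List ℕ, decodeWord k '' {c | c ∈ L} = ↑R := fun k R => by
    choose e he using decodeWord_surjective k
    refine ⟨R.toList.map e, ?_⟩
    ext g
    simp [he]
  constructor
  · rintro ⟨k, R, h1, h2⟩
    obtain ⟨L, hL⟩ := hfin k R
    rw [← hL] at h1 h2
    obtain ⟨c, hc⟩ := computableReduction_iff.1 h1
    obtain ⟨d, hd⟩ := computableReduction_iff.1 h2
    exact ⟨((k, L), c, d), hc, hd⟩
  · rintro ⟨⟨⟨k, L⟩, c, d⟩, hc, hd⟩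
    refine ⟨k, (L.map (decodeWord k)).toFinset, ?_⟩
    have hL : decodeWord k '' {c | c ∈ L} = ↑(L.map (decodeWord k)).toFinset := by
      ext g
      simp
    rw [← hL]
    exact ⟨computableReduction_iff.2 ⟨c, hc⟩, computableReduction_iff.2 ⟨d, hd⟩⟩

theorem isSigma03_FPWordProblemIndices : IsSigma03 FPWordProblemIndices := by
  let Q := ℕ × (ℕ × List ℕ) × Code × Code
  let E : Q → ℕ → ℕ → Prop := fun x => ceer x.1
  let F : Q → ℕ → ℕ → Prop := fun x =>
    wordProblem x.2.1.1 (decodeWord x.2.1.1 '' {c | c ∈ x.2.1.2})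
  have hE : SigmaOne fun x : Q × ℕ × ℕ => E x.1 x.2.1 x.2.2 :=
    sigmaOne_ceer.comp ((Computable.fst.comp Computable.fst).pair Computable.snd)
  have hF : SigmaOne fun x : Q × ℕ × ℕ => F x.1 x.2.1 x.2.2 :=
    sigmaOne_wordProblem.comp ((Computable.fst.comp
      (Computable.snd.comp Computable.fst)).pair Computable.snd)
  have hc : Computable fun x : Q => x.2.2.1 :=
    Computable.fst.comp (Computable.snd.comp Computable.snd)
  have hd : Computable fun x : Q => x.2.2.2 :=
    Computable.snd.comp (Computable.snd.comp Computable.snd)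
  have h := ((piTwo_reducesVia hE hF hc).and (piTwo_reducesVia hF hE hd)).isSigma03
  convert h using 1
  ext i
  exact mem_FPWordProblemIndices_iff i

/-- The canonical code of the exponent sum of the word over one generator coded by `m`. -/
def exponentSum (m : ℕ) : ℕ :=
  let l := (Encodable.decode (α := List (Fin 1 × Bool)) m).getD []
  Nat.pair (l.countP (·.2) - l.countP (!·.2)) (l.countP (!·.2) - l.countP (·.2))

theorem computable_exponentSum : Computable exponentSum := by
  have hl : Primrec fun m : ℕ => (Encodable.decode (α := List (Fin 1 × Bool)) m).getD [] :=
    Primrec.option_getD.comp Primrec.decode (Primrec.const [])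
  have hc : ∀ f : Fin 1 × Bool → Bool,
      Primrec fun m : ℕ => ((Encodable.decode (α := List (Fin 1 × Bool)) m).getD []).countP f := by
    intro f
    have hf : PrimrecPred fun x => f x = true := 
      (Primrec.dom_finite fun x => decide (f x = true)).primrecPred
    exact (Primrec.list_length.comp ((Primrec.listFilter hf).comp hl)).of_eq fun m => by
      simp [List.countP_eq_length_filter]
  exact (Primrec₂.natPair.comp (Primrec.nat_sub.comp (hc _) (hc _))
    (Primrec.nat_sub.comp (hc _) (hc _))).to_comp

/-- The isomorphism of the free group on one generator with `ℤ`. -/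
def exponentHom : FreeGroup (Fin 1) →* Multiplicative ℤ :=
  FreeGroup.lift fun _ => Multiplicative.ofAdd 1

theorem exponentHom_injective : Function.Injective exponentHom := by
  have h : (zpowersHom _ (FreeGroup.of (0 : Fin 1))).comp exponentHom = MonoidHom.id _ := by
    ext j
    fin_cases j
    simp [exponentHom]
  exact Function.LeftInverse.injective (g := zpowersHom _ (FreeGroup.of (0 : Fin 1)))
    fun x => DFunLike.congr_fun h x

theorem exponentHom_mk (l : List (Fin 1 × Bool)) : exponentHom (FreeGroup.mk l) =
    Multiplicative.ofAdd ((l.countP (·.2) : ℤ) - l.countP (!·.2)) := by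
  induction l with
  | nil => exact map_one exponentHom
  | cons x l ih =>
    rw [← List.singleton_append, ← FreeGroup.mul_mk, map_mul, ih]
    obtain ⟨j, b⟩ := x
    apply Multiplicative.toAdd.injective
    cases b <;> simp [exponentHom] <;> ring

theorem wordProblem_int_iff (m n : ℕ) :
    wordProblem 1 ∅ m n ↔ exponentSum m = exponentSum n := by
  rw [wordProblem, presentedGroup_mk_eq, Subgroup.normalClosure_empty, Subgroup.mem_bot,
    inv_mul_eq_one, ← exponentHom_injective.eq_iff, decodeWord, decodeWord, exponentHom_mk,
    exponentHom_mk, Multiplicative.ofAdd.apply_eq_iff_eq, exponentSum, exponentSum,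
    Nat.pair_eq_pair]
  omega

/-- The code of the `m`-th power of the generator. -/
def powerWord (m : ℕ) : ℕ :=
  Encodable.encode ((List.range m).map fun _ => ((0 : Fin 1), true))

theorem computable_powerWord : Computable powerWord :=
  (Primrec.encode.comp (Primrec.list_map Primrec.list_range (Primrec₂.const _))).to_comp

theorem exponentSum_powerWord (m : ℕ) : exponentSum (powerWord m) = Nat.pair m 0 := by
  simp [exponentSum, powerWord, List.countP_replicate]

theorem eqvGen_and_iff {V : ℕ → Prop} {i a b : ℕ}
    (hi : ∀ m, m ∈ W i ↔ V m.unpair.1 ∧ V m.unpair.2) : ceer i a b ↔ a = b ∨ V a ∧ V b := by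
  constructor
  · intro h
    induction h with
    | rel a b h => exact Or.inr (by simpa using (hi _).1 h)
    | refl => exact Or.inl rfl
    | symm _ _ _ ih => exact ih.imp Eq.symm And.symm
    | trans a b c _ _ ih₁ ih₂ =>
      rcases ih₁ with rfl | h₁
      · exact ih₂
      · rcases ih₂ with rfl | h₂
        exacts [Or.inr h₁, Or.inr ⟨h₁.1, h₂.2⟩]
  · rintro (rfl | h)
    exacts [.refl _, .rel _ _ ((hi _).2 (by simpa using h))]

theorem ceerEquiv_int {V : ℕ → Prop} (hV : ComputablePred V) (hodd : ∀ m, ¬V (2 * m + 1)) :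
    CeerEquiv (fun a b => a = b ∨ V a ∧ V b) (wordProblem 1 ∅) := by
  obtain ⟨g, hg, rfl⟩ := ComputablePred.computable_iff.1 hV
  refine ⟨⟨fun m => powerWord (bif g m then 0 else m + 1), computable_powerWord.comp
    (Computable.cond hg (Computable.const 0) Computable.succ), fun m n => ?_⟩,
    ⟨fun m => 2 * exponentSum m + 1, ?_, fun m n => ?_⟩⟩
  · rw [wordProblem_int_iff, exponentSum_powerWord, exponentSum_powerWord, Nat.pair_eq_pair]
    cases hm : g m <;> cases hn : g n <;> simp [hm, hn] <;> rintro rfl <;> simp_all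
  · exact Computable.succ.comp (Primrec.nat_mul.to_comp.comp (Computable.const 2)
      computable_exponentSum)
  · rw [wordProblem_int_iff]
    have := hodd (exponentSum m)
    simp [this]

theorem computablePred_of_ceerEquiv {V : ℕ → Prop} {k : ℕ} {R : Set (FreeGroup (Fin k))}
    (h : CeerEquiv (fun a b => a = b ∨ V a ∧ V b) (wordProblem k R)) : ComputablePred V := by
  classical
  obtain ⟨⟨Φ, hΦ, h1⟩, Ψ, hΨ, h2⟩ := h
  replace h1 : ∀ m n, (m = n ∨ V m ∧ V n) ↔ wordProblem k R (Φ m) (Φ n) := h1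
  replace h2 : ∀ m n, wordProblem k R m n ↔ (Ψ m = Ψ n ∨ V (Ψ m) ∧ V (Ψ n)) := h2
  by_cases hall : ∀ m, V (Ψ m)
  · have : ∀ a b, a = b ∨ V a ∧ V b := fun a b =>
      (h1 a b).2 ((h2 _ _).2 (Or.inr ⟨hall _, hall _⟩))
    refine ComputablePred.computable_iff.2 ⟨fun _ => true, Computable.const _, ?_⟩
    funext a
    simpa using ((this a (a + 1)).resolve_left (by simp)).1
  push Not at hall
  obtain ⟨c, hc⟩ := hall
  by_cases hne : ∃ v, V v
  swap
  · refine ComputablePred.computable_iff.2 ⟨fun _ => false, Computable.const _, ?_⟩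
    funext a
    simpa using fun ha => hne ⟨a, ha⟩
  obtain ⟨v, hv⟩ := hne
  let L : ℕ → List (Fin k × Bool) := fun m => (Encodable.decode m).getD []
  have hL : Primrec L := Primrec.option_getD.comp Primrec.decode (Primrec.const [])
  let μ : ℕ → ℕ := fun a =>
    Encodable.encode (L (Φ a) ++ (FreeGroup.invRev (L (Φ v)) ++ L c))
  have hμ : Computable μ := Computable.encode.comp
    (Computable.list_append.comp (hL.to_comp.comp hΦ) (Computable.const _))
  have hμ' : ∀ a, decodeWord k (μ a) =
      decodeWord k (Φ a) * ((decodeWord k (Φ v))⁻¹ * decodeWord k c) := fun a => by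
    simp [μ, decodeWord, L]
  have key : ∀ a, V a ↔ Ψ (μ a) = Ψ c := by
    intro a
    have e1 : V a ↔ (a = v ∨ V a ∧ V v) :=
      ⟨fun h => Or.inr ⟨h, hv⟩, fun h => h.elim (fun e => e ▸ hv) And.left⟩
    have e2 : Ψ (μ a) = Ψ c ↔ (Ψ (μ a) = Ψ c ∨ V (Ψ (μ a)) ∧ V (Ψ c)) := by simp [hc]
    rw [e1, e2, h1, ← h2, wordProblem, wordProblem, hμ']
    simp only [map_mul, map_inv]
    rw [← mul_assoc, mul_eq_right, mul_inv_eq_one]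
  refine ComputablePred.computable_iff.2 ⟨fun a => decide (Ψ (μ a) = Ψ c),
    computable_decide_eq (hΨ.comp hμ) (Computable.const _), ?_⟩
  funext a
  simp [key]

section Columns

variable {C : ℕ → ℕ → Prop}

/-- The set of even numbers coding the pairs in `C`. -/
def EvenCode (C : ℕ → ℕ → Prop) (v : ℕ) : Prop :=
  ∃ q : ℕ × ℕ, v = 2 * Nat.pair q.1 q.2 ∧ C q.1 q.2

theorem evenCode_pair {x t : ℕ} : EvenCode C (2 * Nat.pair x t) ↔ C x t := by
  constructor
  · rintro ⟨q, hq, h⟩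
    obtain ⟨rfl, rfl⟩ := Nat.pair_eq_pair.1 (Nat.eq_of_mul_eq_mul_left two_pos hq)
    exact h
  · exact fun h => ⟨(x, t), rfl, h⟩

/-- A set whose columns are initial segments, almost all of them full, is computable. -/
theorem computablePred_evenCode (hC : ∀ x t t', t' ≤ t → C x t → C x t') {N : ℕ}
    (hN : ∀ x t, N ≤ x → C x t) : ComputablePred (EvenCode C) := by
  classical
  let b : ℕ → ℕ := fun x => if h : ∃ t, ¬C x t then Nat.find h + 1 else 0
  let T : List ℕ := (List.range N).map b
  have hb : ∀ x t, C x t ↔ b x = 0 ∨ t + 1 < b x := by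
    intro x t
    by_cases h : ∃ t, ¬C x t
    · simp only [b, dif_pos h, Nat.add_lt_add_iff_right]
      constructor
      · intro hxt
        by_contra hcon
        exact Nat.find_spec h (hC x t _ (by omega) hxt)
      · rintro (h' | h')
        · omega
        · exact not_not.1 (Nat.find_min h h')
    · simp only [b, dif_neg h]
      push Not at h
      simp [h]
  have hT : ∀ x t, C x t ↔ T.getD x default = 0 ∨ t + 1 < T.getD x default := by
    intro x t
    by_cases hx : x < N
    · rw [hb]
      simp [T, List.getD, hx]
    · simp [T, List.getD, hN x t (not_lt.1 hx), hx]
  have hp : Computable fun v : ℕ => Nat.unpair (v / 2) :=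
    Computable.unpair.comp (Primrec.nat_div.to_comp.comp Computable.id (Computable.const 2))
  have hg := computable_list_getD (Computable.const T) (Computable.fst.comp hp)
  refine ComputablePred.computable_iff.2 ⟨fun v => decide (v = 2 * (v / 2)) &&
    (decide (T.getD (v / 2).unpair.1 default = 0) ||
      decide ((v / 2).unpair.2 + 1 < T.getD (v / 2).unpair.1 default)), ?_, ?_⟩
  · exact computable_and (computable_decide_eq Computable.id (Primrec.nat_mul.to_comp.comp
      (Computable.const 2) (Primrec.nat_div.to_comp.comp Computable.id (Computable.const 2))))
      (computable_or (computable_decide_eq hg (Computable.const 0))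
        (computable_decide_lt (Computable.succ.comp (Computable.snd.comp hp)) hg))
  · funext v
    simp only [Bool.and_eq_true, Bool.or_eq_true, decide_eq_true_eq, eq_iff_iff, ← hT]
    constructor
    · rintro ⟨q, rfl, h⟩
      simpa using h
    · rintro ⟨h1, h2⟩
      exact ⟨_, by simpa using h1, h2⟩

end Columns

/-- The `x`-th program is seen to halt on input `0` within `s` steps. -/
def haltsBy (s x : ℕ) : Bool := (Code.evaln s (Denumerable.ofNat Code x) 0).isSome

theorem computable_haltsBy : Computable₂ haltsBy :=
  Primrec.option_isSome.to_comp.comp (Code.primrec_evaln.to_comp.comp (Computable.pair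
    (Computable.pair Computable.fst ((Computable.ofNat Code).comp Computable.snd))
    (Computable.const 0)))

theorem haltsBy_mono {s t x : ℕ} (h : s ≤ t) (hs : haltsBy s x = true) : haltsBy t x = true := by
  obtain ⟨a, ha⟩ := Option.isSome_iff_exists.1 hs
  exact Option.isSome_iff_exists.2 ⟨a, Code.evaln_mono h ha⟩

theorem dom_iff_haltsBy (c : Code) :
    (c.eval 0).Dom ↔ ∃ s, haltsBy s (Encodable.encode c) = true := by
  simp only [Part.dom_iff_mem, Code.evaln_complete, haltsBy, Denumerable.ofNat_encode,
    Option.isSome_iff_exists, Option.mem_def]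
  exact exists_comm

/-- The columns coding both a `Σ⁰₃` condition and the halting problem. -/
def HardColumn (R : ℕ → ℕ → ℕ → Bool) (x t : ℕ) : Prop :=
  (∃ x', x' < x + 1 ∧ ∀ y < t + 1, ∃ z, R x' y z = true) ∨
    (∃ s, haltsBy s x = true) ∧ (!haltsBy t x) = true

theorem computablePred_hardColumn {R : ℕ → ℕ → ℕ → Bool} (h : ∃ x, ∀ y, ∃ z, R x y z = true) :
    ComputablePred (EvenCode (HardColumn R)) := by
  obtain ⟨N, hN⟩ := h
  refine computablePred_evenCode (N := N) ?_ fun x t hx =>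
    Or.inl ⟨N, by omega, fun y _ => hN y⟩
  rintro x t t' ht (⟨x', hx', h⟩ | ⟨h1, h2⟩)
  · exact Or.inl ⟨x', hx', fun y hy => h y (by omega)⟩
  · refine Or.inr ⟨h1, ?_⟩
    rw [Bool.not_eq_true', ← Bool.not_eq_true] at h2 ⊢
    exact fun hh => h2 (haltsBy_mono ht hh)

theorem not_computablePred_hardColumn {R : ℕ → ℕ → ℕ → Bool}
    (h : ¬∃ x, ∀ y, ∃ z, R x y z = true) : ¬ComputablePred (EvenCode (HardColumn R)) := by
  intro hV
  push Not at h
  choose y hy using h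
  obtain ⟨g, hg, hV⟩ := ComputablePred.computable_iff.1 hV
  have hgC : ∀ x t, g (2 * Nat.pair x t) = true ↔ HardColumn R x t := fun x t => by
    rw [← evenCode_pair (C := HardColumn R), hV]
  have hex : ∀ x, ∃ t, (!g (2 * Nat.pair x t)) = true := by
    intro x
    obtain ⟨t₀, ht₀⟩ : ∃ t₀, (∃ s, haltsBy s x = true) → haltsBy t₀ x = true := by
      by_cases hs : ∃ s, haltsBy s x = true
      · exact hs.imp fun s hs _ => hs
      · exact ⟨0, fun h => (hs h).elim⟩
    refine ⟨max t₀ ((Finset.range (x + 1)).sup y), ?_⟩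
    rw [Bool.not_eq_true', ← Bool.not_eq_true, hgC]
    rintro (⟨x', hx', hz⟩ | ⟨h1, h2⟩)
    · have := Finset.le_sup (f := y) (Finset.mem_range.2 hx')
      obtain ⟨z, hz⟩ := hz (y x') (by omega)
      exact hy x' z hz
    · rw [Bool.not_eq_true', ← Bool.not_eq_true] at h2
      exact h2 (haltsBy_mono (le_max_left _ _) (ht₀ h1))
  have hpred : Computable fun q : ℕ × ℕ => !g (2 * Nat.pair q.1 q.2) :=
    Primrec.not.to_comp.comp (hg.comp (Primrec.nat_mul.to_comp.comp (Computable.const 2)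
      (Primrec₂.natPair.to_comp.comp Computable.fst Computable.snd)))
  have hfind : Computable fun x => Nat.find (hex x) := by
    have hp : Partrec fun x => Nat.rfind fun t => Part.some (!g (2 * Nat.pair x t)) :=
      Partrec.rfind hpred.partrec
    exact hp.of_eq_tot fun x => Nat.mem_rfind.2 ⟨by simpa using Nat.find_spec (hex x), fun hm =>
      by simpa using Nat.find_min (hex x) hm⟩
  refine ComputablePred.halting_problem 0 (ComputablePred.computable_iff.2
    ⟨fun c => haltsBy (Nat.find (hex (Encodable.encode c))) (Encodable.encode c),
      computable_haltsBy.comp (hfind.comp Computable.encode) Computable.encode, ?_⟩)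
  funext c
  rw [dom_iff_haltsBy, eq_iff_iff]
  refine ⟨fun hs => ?_, fun hs => ⟨_, hs⟩⟩
  have h1 := Nat.find_spec (hex (Encodable.encode c))
  rw [Bool.not_eq_true', ← Bool.not_eq_true, hgC] at h1
  by_contra h2
  exact h1 (Or.inr ⟨hs, by simpa using h2⟩)

theorem sigmaOne_evenCode_hardColumn {R : ℕ → ℕ → ℕ → ℕ → Bool}
    (hR : Computable fun p : ℕ × ℕ × ℕ × ℕ => R p.1 p.2.1 p.2.2.1 p.2.2.2) :
    SigmaOne fun p : ℕ × ℕ => EvenCode (HardColumn (R p.1)) p.2 := by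
  have hR' : SigmaOne fun p : ((ℕ × ℕ × ℕ) × ℕ) × ℕ => ∃ z, R p.1.1.1 p.1.2 p.2 z = true := by
    have h1 : Computable fun p : (((ℕ × ℕ × ℕ) × ℕ) × ℕ) × ℕ =>
        (p.1.1.1.1, p.1.1.2, p.1.2, p.2) :=
      (Computable.fst.comp (Computable.fst.comp (Computable.fst.comp Computable.fst))).pair
        ((Computable.snd.comp (Computable.fst.comp Computable.fst)).pair
          ((Computable.snd.comp Computable.fst).pair Computable.snd))
    exact (SigmaOne.of_computable (hR.comp h1)).exists_nat
  have hx : Computable fun p : ℕ × ℕ × ℕ => p.2.1 := Computable.fst.comp Computable.snd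
  have ht : Computable fun p : ℕ × ℕ × ℕ => p.2.2 := Computable.snd.comp Computable.snd
  have h2 := ((SigmaOne.lt Computable.snd (Computable.succ.comp (hx.comp Computable.fst))).and
    (hR'.forall_lt (Computable.succ.comp (ht.comp Computable.fst)))).exists_nat
  have h3 := (SigmaOne.of_computable (computable_haltsBy.comp Computable.snd
    (hx.comp Computable.fst))).exists_nat.and
    (SigmaOne.of_computable (Primrec.not.to_comp.comp (computable_haltsBy.comp ht hx)))
  have h4 : SigmaOne fun p : ℕ × ℕ × ℕ => HardColumn (R p.1) p.2.1 p.2.2 := h2.or h3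
  have hq : Computable fun p : (ℕ × ℕ) × ℕ × ℕ => 2 * Nat.pair p.2.1 p.2.2 :=
    Primrec.nat_mul.to_comp.comp (Computable.const 2) (Primrec₂.natPair.to_comp.comp
      (Computable.fst.comp Computable.snd) (Computable.snd.comp Computable.snd))
  exact ((SigmaOne.eq (Computable.snd.comp Computable.fst) hq).and (h4.comp
    ((Computable.fst.comp Computable.fst).pair Computable.snd))).exists_code

theorem manyOneReducible_FPWordProblemIndices {A : Set ℕ} (hA : IsSigma03 A) :
    (· ∈ A) ≤₀ (· ∈ FPWordProblemIndices) := by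
  obtain ⟨R, hR, hA⟩ := hA
  have hV := sigmaOne_evenCode_hardColumn hR
  obtain ⟨f, hf, hW⟩ := ((hV.comp (Computable.fst.pair
    (computable_unpair_fst.comp Computable.snd))).and (hV.comp (Computable.fst.pair
      (computable_unpair_snd.comp Computable.snd)))).exists_index
  refine ⟨f, hf, fun n => ?_⟩
  have hE : ceer (f n) = fun a b => a = b ∨
      EvenCode (HardColumn (R n)) a ∧ EvenCode (HardColumn (R n)) b := by
    funext a b
    exact propext (eqvGen_and_iff (hW n))
  change n ∈ A ↔ ∃ k R', _
  rw [hA, hE]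
  constructor
  · intro h
    refine ⟨1, ∅, ?_⟩
    rw [Finset.coe_empty]
    refine ceerEquiv_int (computablePred_hardColumn h) ?_
    rintro m ⟨q, hq, -⟩
    omega
  · rintro ⟨k, R', h⟩
    by_contra hn
    exact not_computablePred_hardColumn hn (computablePred_of_ceerEquiv h)

/-- The set of indices of ceers computably equivalent to the word problem of a finitely
presented group is Σ⁰₃-complete. -/
theorem FPWordProblemIndices_Sigma03Complete :
    IsSigma03 FPWordProblemIndices ∧
      ∀ A : Set ℕ, IsSigma03 A → (· ∈ A) ≤₀ (· ∈ FPWordProblemIndices) :=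
  ⟨isSigma03_FPWordProblemIndices, fun _ hA => manyOneReducible_FPWordProblemIndices hA⟩
end
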